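/- Let p ∈ (1,∞), n ≥ 2, k ∈ {1,…,n−1}, and −∞ < a_i < b_i < ∞ for i = 1,…,n−k; set D = ℝ^k × ∏_{i=1}^{n−k}(a_i,b_i) ⊆ ℝⁿ, and let I denote the canonical embedding W_0^{1,p}(D) ↪ L^p(D). Then for every strict s-number s and every m ∈ ℕ, s_m(I) = ‖I‖ = (1 + π_p^p (p−1) Σ_{i=1}^{n−k} (b_i−a_i)^{−p})^{−1/p}. -/

import Mathlib

open MeasureTheory ENNReal Set Filter Topology

noncomputable section

/-- The `i`-th partial derivative of `u : ℝⁿ → ℝ`. -/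
def pder {n : ℕ} (i : Fin n) (u : (Fin n → ℝ) → ℝ) (x : Fin n → ℝ) : ℝ :=
  fderiv ℝ u x (Pi.single i 1)

/-- `u` is a smooth function compactly supported in the open set `D`. -/
def IsTestFun {n : ℕ} (D : Set (Fin n → ℝ)) (u : (Fin n → ℝ) → ℝ) : Prop :=
  ContDiff ℝ (⊤ : ℕ∞) u ∧ HasCompactSupport u ∧ tsupport u ⊆ D

/-- The strip-like domain `ℝᵏ × ∏_{i ≥ k} (aᵢ, bᵢ)`, realized as a subset of `ℝⁿ`:
the coordinates `i < k` are free, the coordinates `i ≥ k` are constrained to `(aᵢ, bᵢ)`. -/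
def stripDomain (n k : ℕ) (a b : Fin n → ℝ) : Set (Fin n → ℝ) :=
  {x | ∀ i : Fin n, k ≤ (i : ℕ) → x i ∈ Set.Ioo (a i) (b i)}

/-- The ambient space `V = L^p(ℝⁿ; ℓ^p(ℝ^{n+1}))`, in which the Sobolev space `W^{1,p}_0`
is realized as the closure of the set of "jets" `(u, ∇u)` of test functions. -/
abbrev Vsp (n : ℕ) (p : ℝ≥0∞) [Fact (1 ≤ p)] :=
  Lp (PiLp p (fun _ : Fin (n + 1) => ℝ)) p (volume : Measure (Fin n → ℝ))

/-- The "jet" `(u, ∂₁u, …, ∂ₙu)` of a function, valued in `ℓ^p(ℝ^{n+1})`. -/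
def jet {n : ℕ} (p : ℝ≥0∞) (u : (Fin n → ℝ) → ℝ) (x : Fin n → ℝ) :
    PiLp p (fun _ : Fin (n + 1) => ℝ) :=
  (WithLp.equiv p (∀ _ : Fin (n + 1), ℝ)).symm (Fin.cons (u x) (fun i => pder i u x))

/-- `W^{1,p}_0(D)` realized as a closed subspace of `V`:
the closure of the subspace of jets of test functions supported in `D`.
The (subspace) norm of the jet of `u` is exactly
`(‖u‖_p^p + ‖ |∇u|_{ℓ^p} ‖_p^p)^{1/p}`, i.e., the `W^{1,p}`-norm of `u`. -/
def W0sub {n : ℕ} (p : ℝ≥0∞) [Fact (1 ≤ p)] (D : Set (Fin n → ℝ)) : Submodule ℝ (Vsp n p) :=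
  (Submodule.span ℝ {f : Vsp n p | ∃ u : (Fin n → ℝ) → ℝ, IsTestFun D u ∧
    (f : (Fin n → ℝ) → PiLp p (fun _ : Fin (n + 1) => ℝ)) =ᵐ[volume] jet p u}).topologicalClosure

instance W0sub.completeSpace {n : ℕ} (p : ℝ≥0∞) [Fact (1 ≤ p)] (D : Set (Fin n → ℝ)) :
    CompleteSpace (W0sub (n := n) p D) :=
  (Submodule.isClosed_topologicalClosure _).completeSpace_coe

/-- Projection of a jet onto its zeroth (function) component. -/
def proj0 (n : ℕ) (p : ℝ≥0∞) [Fact (1 ≤ p)] : PiLp p (fun _ : Fin (n + 1) => ℝ) →L[ℝ] ℝ :=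
  (ContinuousLinearMap.proj (0 : Fin (n + 1))).comp
    (PiLp.continuousLinearEquiv p ℝ (fun _ : Fin (n + 1) => ℝ)).toContinuousLinearMap

/-- Projection of a jet onto its gradient components, valued in `ℓ^p(ℝⁿ)`. -/
def projGrad (n : ℕ) (p : ℝ≥0∞) [Fact (1 ≤ p)] :
    PiLp p (fun _ : Fin (n + 1) => ℝ) →L[ℝ] PiLp p (fun _ : Fin n => ℝ) :=
  ((PiLp.continuousLinearEquiv p ℝ (fun _ : Fin n => ℝ)).symm.toContinuousLinearMap).comp
    ((ContinuousLinearMap.pi fun i : Fin n => ContinuousLinearMap.proj (R := ℝ) i.succ).comp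
      (PiLp.continuousLinearEquiv p ℝ (fun _ : Fin (n + 1) => ℝ)).toContinuousLinearMap)

/-- The canonical Sobolev embedding `I : W^{1,p}_0(D) → L^p(D)` (as a map into `L^p(ℝⁿ)`;
all functions in `W^{1,p}_0(D)` vanish a.e. outside `D`). -/
def SobolevEmb {n : ℕ} (p : ℝ≥0∞) [Fact (1 ≤ p)] (D : Set (Fin n → ℝ)) :
    W0sub (n := n) p D →L[ℝ] Lp ℝ p (volume : Measure (Fin n → ℝ)) :=
  ((proj0 n p).compLpL p volume).comp (W0sub p D).subtypeL

/-- The gradient map `W^{1,p}_0(D) → L^p(D; ℓ^p(ℝⁿ))`, `u ↦ ∇u`. -/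
def SobolevGrad {n : ℕ} (p : ℝ≥0∞) [Fact (1 ≤ p)] (D : Set (Fin n → ℝ)) :
    W0sub (n := n) p D →L[ℝ] Lp (PiLp p (fun _ : Fin n => ℝ)) p (volume : Measure (Fin n → ℝ)) :=
  ((projGrad n p).compLpL p volume).comp (W0sub p D).subtypeL

/-- `π_p = 2 ∫₀¹ (1 - sᵖ)^{-1/p} ds`. -/
def piP (p : ℝ) : ℝ := 2 * ∫ s in (0 : ℝ)..1, (1 - s ^ p) ^ (-1 / p)

/-- The inverse of `t ↦ ∫₀ᵗ (1 - sᵖ)^{-1/p} ds` on `[0,1]`; this is `sin_p` on `[0, π_p/2]`. -/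
def sinpHalf (p : ℝ) : ℝ → ℝ :=
  Function.invFunOn (fun t : ℝ => ∫ s in (0 : ℝ)..t, (1 - s ^ p) ^ (-1 / p)) (Set.Icc 0 1)

/-- `sin_p` on `[0, π_p]`, by reflection around `π_p/2`. -/
def sinpBase (p t : ℝ) : ℝ :=
  if t ≤ piP p / 2 then sinpHalf p t else sinpHalf p (piP p - t)

/-- `sin_p` on `[-π_p, π_p]`, by odd reflection. -/
def sinpSym (p t : ℝ) : ℝ := if 0 ≤ t then sinpBase p t else -sinpBase p (-t)

/-- The generalized sine function `sin_p`, extended `2π_p`-periodically to all of `ℝ`. -/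
def sinp (p t : ℝ) : ℝ :=
  sinpSym p (t - 2 * piP p * ⌊(t + piP p) / (2 * piP p)⌋)

/-- The generalized cosine function `cos_p = (sin_p)'`. -/
def cosp (p : ℝ) : ℝ → ℝ := deriv (sinp p)

/-- The `m`-th entropy number of a bounded linear operator: the infimum of all `ε > 0` such
that the image of the closed unit ball can be covered by `2^{m-1}` balls of radius `ε`. -/
def entropyNumber {X Y : Type*} [NormedAddCommGroup X] [NormedSpace ℝ X]
    [NormedAddCommGroup Y] [NormedSpace ℝ Y] (m : ℕ) (T : X →L[ℝ] Y) : ℝ :=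
  sInf {ε : ℝ | 0 < ε ∧ ∃ c : Fin (2 ^ (m - 1)) → Y,
    ∀ x : X, ‖x‖ ≤ 1 → ∃ j, ‖T x - c j‖ ≤ ε}

end

/-- A strict `s`-number: a rule assigning to each bounded linear operator between (real)
Banach spaces a sequence of nonnegative numbers satisfying (S1)–(S5). (Sequences are indexed
so that the properties hold for indices `m ≥ 1`.) -/
structure StrictSNumber where
  /-- the assignment `T ↦ (s_m(T))_m` -/
  s : ∀ {X Y : Type} [NormedAddCommGroup X] [NormedSpace ℝ X] [CompleteSpace X]
    [NormedAddCommGroup Y] [NormedSpace ℝ Y] [CompleteSpace Y], (X →L[ℝ] Y) → ℕ → ℝ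
  nonneg : ∀ {X Y : Type} [NormedAddCommGroup X] [NormedSpace ℝ X] [CompleteSpace X]
    [NormedAddCommGroup Y] [NormedSpace ℝ Y] [CompleteSpace Y] (T : X →L[ℝ] Y) (m : ℕ),
    0 ≤ s T m
  /-- (S1): `s_1(T) = ‖T‖` -/
  first_eq_norm : ∀ {X Y : Type} [NormedAddCommGroup X] [NormedSpace ℝ X] [CompleteSpace X]
    [NormedAddCommGroup Y] [NormedSpace ℝ Y] [CompleteSpace Y] (T : X →L[ℝ] Y), s T 1 = ‖T‖
  /-- (S1): monotonicity -/
  antitone : ∀ {X Y : Type} [NormedAddCommGroup X] [NormedSpace ℝ X] [CompleteSpace X]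
    [NormedAddCommGroup Y] [NormedSpace ℝ Y] [CompleteSpace Y] (T : X →L[ℝ] Y) (m : ℕ),
    1 ≤ m → s T (m + 1) ≤ s T m
  /-- (S2): `s_m(S + T) ≤ s_m(S) + ‖T‖` -/
  add_le : ∀ {X Y : Type} [NormedAddCommGroup X] [NormedSpace ℝ X] [CompleteSpace X]
    [NormedAddCommGroup Y] [NormedSpace ℝ Y] [CompleteSpace Y] (S T : X →L[ℝ] Y) (m : ℕ),
    1 ≤ m → s (S + T) m ≤ s S m + ‖T‖
  /-- (S3): `s_m(B T A) ≤ ‖B‖ s_m(T) ‖A‖` -/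
  comp_le : ∀ {W X Y Z : Type} [NormedAddCommGroup W] [NormedSpace ℝ W] [CompleteSpace W]
    [NormedAddCommGroup X] [NormedSpace ℝ X] [CompleteSpace X]
    [NormedAddCommGroup Y] [NormedSpace ℝ Y] [CompleteSpace Y]
    [NormedAddCommGroup Z] [NormedSpace ℝ Z] [CompleteSpace Z]
    (A : W →L[ℝ] X) (T : X →L[ℝ] Y) (B : Y →L[ℝ] Z) (m : ℕ), 1 ≤ m →
    s ((B.comp T).comp A) m ≤ ‖B‖ * s T m * ‖A‖
  /-- (S4): `s_m(id_E) = 1` whenever `dim E ≥ m` -/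
  id_eq_one : ∀ {E : Type} [NormedAddCommGroup E] [NormedSpace ℝ E] [CompleteSpace E] (m : ℕ),
    1 ≤ m → (m : Cardinal) ≤ Module.rank ℝ E → s (ContinuousLinearMap.id ℝ E) m = 1
  /-- (S5): `s_m(T) = 0` whenever `rank T < m` -/
  rank_lt : ∀ {X Y : Type} [NormedAddCommGroup X] [NormedSpace ℝ X] [CompleteSpace X]
    [NormedAddCommGroup Y] [NormedSpace ℝ Y] [CompleteSpace Y] (T : X →L[ℝ] Y) (m : ℕ),
    1 ≤ m → Module.rank ℝ (LinearMap.range (T : X →ₗ[ℝ] Y)) < (m : Cardinal) → s T m = 0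

lemma integrableOn_inv_one_add_rpow {q : ℝ} (hq : 1 < q) :
    IntegrableOn (fun t : ℝ => (1 + |t| ^ q)⁻¹) (Ioi 0) := by
  have hc : Continuous fun t : ℝ => (1 + |t| ^ q)⁻¹ := by
    refine Continuous.inv₀ (continuous_const.add
      (continuous_abs.rpow_const fun _ => Or.inr (by linarith))) fun t => ?_
    positivity
  rw [← Ioc_union_Ioi_eq_Ioi (zero_le_one' ℝ)]
  refine IntegrableOn.union ?_ ?_
  · exact (hc.integrableOn_Icc (a := 0) (b := 1)).mono_set Ioc_subset_Icc_self
  · refine Integrable.mono' (integrableOn_Ioi_rpow_of_lt (a := -q) (by linarith) one_pos)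
      hc.aestronglyMeasurable ?_
    refine (ae_restrict_mem measurableSet_Ioi).mono fun t ht => ?_
    have ht0 : (0 : ℝ) < t := lt_trans one_pos ht
    rw [Real.norm_of_nonneg (by positivity), abs_of_pos ht0, Real.rpow_neg ht0.le]
    exact inv_anti₀ (by positivity) (by linarith)

lemma integral_inv_one_add_rpow {p q : ℝ} (hpq : p.HolderConjugate q) :
    ∫ t in Ioi (0 : ℝ), (1 + |t| ^ q)⁻¹ = (p - 1) * piP p / 2 := by
  have hp := hpq.lt
  have hp0 := hpq.pos
  have hq0 := hpq.symm.pos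
  have hderiv : ∀ t ∈ Ioi (0 : ℝ), HasDerivWithinAt (fun t : ℝ => (1 + t ^ q) ^ (-1 / p))
      (-((p - 1)⁻¹ * (t ^ (q - 1) * (1 + t ^ q) ^ (-1 / p - 1)))) (Ioi 0) t := by
    intro t ht
    have ht0 : (0 : ℝ) < t := ht
    have h1 : HasDerivAt (fun t : ℝ => 1 + t ^ q) (q * t ^ (q - 1)) t :=
      (Real.hasDerivAt_rpow_const (Or.inl ht0.ne')).const_add 1
    have h2 := h1.rpow_const (p := -1 / p) (Or.inl (by positivity))
    refine (h2.congr_deriv ?_).hasDerivWithinAt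
    have : q = p / (p - 1) := hpq.conjugate_eq
    have hp1 : p - 1 ≠ 0 := by linarith
    have : q / p = (p - 1)⁻¹ := by rw [this]; field_simp
    rw [← this]; ring
  have hanti : StrictAntiOn (fun t : ℝ => (1 + t ^ q) ^ (-1 / p)) (Ioi 0) := by
    intro x hx y hy hxy
    have hx0 : (0 : ℝ) < x := hx
    refine Real.rpow_lt_rpow_of_neg (by positivity) ?_ (by rw [neg_div]; simp [hp0])
    have := Real.rpow_lt_rpow hx0.le hxy hq0
    linarith
  have himg : (fun t : ℝ => (1 + t ^ q) ^ (-1 / p)) '' Ioi 0 = Ioo 0 1 := by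
    ext s
    constructor
    · rintro ⟨t, ht, rfl⟩
      have ht0 : (0 : ℝ) < t := ht
      have := Real.rpow_pos_of_pos ht0 q
      exact ⟨by positivity, Real.rpow_lt_one_of_one_lt_of_neg (by linarith)
        (by rw [neg_div]; simp [hp0])⟩
    · rintro ⟨hs0, hs1⟩
      have h1 : 1 < s ^ (-p) := Real.one_lt_rpow_of_pos_of_lt_one_of_neg hs0 hs1 (by linarith)
      refine ⟨(s ^ (-p) - 1) ^ (1 / q), ?_, ?_⟩
      · exact Real.rpow_pos_of_pos (by linarith) _
      · simp only
        rw [← Real.rpow_mul (by linarith), one_div_mul_cancel hq0.ne', Real.rpow_one,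
          add_sub_cancel, ← Real.rpow_mul hs0.le]
        rw [show -p * (-1 / p) = 1 by field_simp, Real.rpow_one]
  have key := integral_image_eq_integral_abs_deriv_smul measurableSet_Ioi hderiv hanti.injOn
    (fun s : ℝ => (1 - s ^ p) ^ (-1 / p))
  rw [himg] at key
  have hpi : piP p = 2 * ∫ s in Ioo (0 : ℝ) 1, (1 - s ^ p) ^ (-1 / p) := by
    rw [piP, intervalIntegral.integral_of_le zero_le_one, integral_Ioc_eq_integral_Ioo]
  rw [hpi, key]
  rw [show ∀ X : ℝ, (p - 1) * (2 * X) / 2 = (p - 1) * X by intro X; ring,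
    ← integral_const_mul]
  refine setIntegral_congr_fun measurableSet_Ioi fun t ht => ?_
  have ht0 : (0 : ℝ) < t := ht
  have hp1 : 0 < p - 1 := by linarith
  have hA : 0 < 1 + t ^ q := by positivity
  have e1 : ((1 + t ^ q) ^ (-1 / p)) ^ p = (1 + t ^ q)⁻¹ := by
    rw [← Real.rpow_mul hA.le, div_mul_cancel₀ _ hp0.ne', Real.rpow_neg_one]
  have e2 : 1 - (1 + t ^ q)⁻¹ = t ^ q * (1 + t ^ q)⁻¹ := by field_simp; ring
  have e3 : (t ^ q * (1 + t ^ q)⁻¹) ^ (-1 / p) = t ^ (-(q - 1)) * (1 + t ^ q) ^ (1 / p) := by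
    rw [Real.mul_rpow (by positivity) (by positivity), ← Real.rpow_mul ht0.le,
      Real.inv_rpow hA.le, ← Real.rpow_neg hA.le]
    congr 2
    · have := hpq.sub_one_mul_conj
      have : q - 1 = q / p := by rw [hpq.conjugate_eq]; field_simp; ring
      rw [this]; ring
    · ring
  simp only [smul_eq_mul]
  rw [abs_of_pos ht0, abs_neg, abs_of_pos (by positivity), e1, e2, e3,
    Real.rpow_sub_one hA.ne']
  have e4 : t ^ (q - 1) * t ^ (-(q - 1)) = 1 := by
    rw [← Real.rpow_add ht0]; simp
  have e5 : (1 + t ^ q) ^ (-1 / p) * (1 + t ^ q) ^ (1 / p) = 1 := by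
    rw [← Real.rpow_add hA]; simp [neg_div]
  calc (1 + t ^ q)⁻¹ = ((p - 1) * (p - 1)⁻¹) * (t ^ (q - 1) * t ^ (-(q - 1))) *
        ((1 + t ^ q) ^ (-1 / p) * (1 + t ^ q) ^ (1 / p)) * (1 + t ^ q)⁻¹ := by
        rw [e4, e5, mul_inv_cancel₀ hp1.ne']; ring
    _ = _ := by ring

/-- A solution of the Riccati equation `w' = 1 + |w|^q` on its maximal interval. -/
lemma exists_riccati {p q : ℝ} (hpq : p.HolderConjugate q) :
    ∃ w : ℝ → ℝ,
      (∀ x ∈ Ioo (-((p - 1) * piP p / 2)) ((p - 1) * piP p / 2),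
        HasDerivAt w (1 + |w x| ^ q) x) ∧
      ∀ R : ℝ, ∃ x ∈ Ioo (-((p - 1) * piP p / 2)) ((p - 1) * piP p / 2), w x = R := by
  have hq := hpq.symm.lt
  set J := (p - 1) * piP p / 2 with hJ
  set φ : ℝ → ℝ := fun t => (1 + |t| ^ q)⁻¹ with hφ
  have hc : Continuous φ := by
    refine Continuous.inv₀ (continuous_const.add
      (continuous_abs.rpow_const fun _ => Or.inr (by linarith))) fun t => ?_
    positivity
  have hpos : ∀ t, 0 < φ t := fun t => by simp only [hφ]; positivity
  set F : ℝ → ℝ := fun v => ∫ t in (0 : ℝ)..v, φ t with hF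
  have hFd : ∀ v, HasDerivAt F (φ v) v := fun v =>
    intervalIntegral.integral_hasDerivAt_right (hc.intervalIntegrable _ _)
      hc.aestronglyMeasurable.stronglyMeasurableAtFilter hc.continuousAt
  have hFc : Continuous F := continuous_iff_continuousAt.2 fun v => (hFd v).continuousAt
  have hFmono : StrictMono F := strictMono_of_deriv_pos fun v => by
    rw [(hFd v).deriv]; exact hpos v
  have hFodd : ∀ v, F (-v) = -F v := by
    intro v
    have := intervalIntegral.integral_comp_neg (a := 0) (b := v) φ
    simp only [hF]
    rw [intervalIntegral.integral_symm, ← neg_zero, ← this]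
    simp [hφ]
  have hFtop : Tendsto F atTop (𝓝 J) := by
    have := intervalIntegral_tendsto_integral_Ioi (0 : ℝ)
      (integrableOn_inv_one_add_rpow hq) tendsto_id
    rwa [integral_inv_one_add_rpow hpq] at this
  have hlt : ∀ v, F v < J := fun v =>
    (hFmono (lt_add_one v)).trans_le (hFmono.monotone.ge_of_tendsto hFtop _)
  have hgt : ∀ v, -J < F v := fun v => by
    have := hlt (-v); rw [hFodd] at this; linarith
  have hsurj : ∀ x ∈ Ioo (-J) J, ∃ v, F v = x := by
    intro x hx
    obtain ⟨v₂, h₂⟩ := (hFtop.eventually (lt_mem_nhds hx.2)).exists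
    have hx' : -x < J := by linarith [hx.1]
    obtain ⟨v₁, h₁⟩ := (hFtop.eventually (lt_mem_nhds hx')).exists
    have h₁' : F (-v₁) < x := by rw [hFodd]; linarith
    obtain ⟨v, -, hv⟩ := intermediate_value_Icc (hFmono.lt_iff_lt.1 (h₁'.trans h₂)).le
      hFc.continuousOn ⟨h₁'.le, h₂.le⟩
    exact ⟨v, hv⟩
  set w := Function.invFun F with hw
  have hwF : ∀ v, w (F v) = v := Function.leftInverse_invFun hFmono.injective
  have hFw : ∀ x ∈ Ioo (-J) J, F (w x) = x := fun x hx => Function.invFun_eq (hsurj x hx)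
  have hwmono : StrictMonoOn w (Ioo (-J) J) := fun x hx y hy hxy => by
    rw [← hFmono.lt_iff_lt, hFw x hx, hFw y hy]; exact hxy
  have himg : w '' Ioo (-J) J = univ := eq_univ_of_forall fun v =>
    ⟨F v, ⟨hgt v, hlt v⟩, hwF v⟩
  refine ⟨w, fun x hx => ?_, fun R => ⟨F R, ⟨hgt R, hlt R⟩, hwF R⟩⟩
  have hxn : Ioo (-J) J ∈ 𝓝 x := Ioo_mem_nhds hx.1 hx.2
  have hcont : ContinuousAt w x := hwmono.continuousAt_of_image_mem_nhds hxn (by simp [himg])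
  have := HasDerivAt.of_local_left_inverse hcont (hFd (w x)) (hpos _).ne'
    (by filter_upwards [hxn] with y hy using hFw y hy)
  simpa [hφ] using this

lemma piP_pos {p : ℝ} (hp : 1 < p) : 0 < piP p := by
  obtain ⟨w, -, h⟩ := exists_riccati (Real.HolderConjugate.conjExponent hp)
  obtain ⟨x, hx, -⟩ := h 0
  have h1 : 0 < (p - 1) * piP p / 2 := by linarith [hx.1, hx.2]
  have h2 : 0 < (p - 1) * piP p := by linarith
  exact (pos_iff_pos_of_mul_pos h2).1 (by linarith)

lemma riccati_young {p q c : ℝ} (hpq : p.HolderConjugate q) (hc : 0 < c) (y z W : ℝ) :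
    c * |y| ^ p - ((p - 1) / c) ^ (p - 1) * |z| ^ p ≤
      p * |y| ^ (p - 2) * y * z * W + |y| ^ p * (c * (1 + |W| ^ q)) := by
  have hp := hpq.lt
  have hp0 := hpq.pos
  have hq0 := hpq.symm.pos
  have hp1 : 0 < p - 1 := by linarith
  have hr : 0 < (p - 1) / c := by positivity
  set μ := ((p - 1) / c) ^ (1 / q) with hμ
  have hμ0 : 0 < μ := Real.rpow_pos_of_pos hr _
  have hqp : p / q = p - 1 := by rw [hpq.conjugate_eq]; field_simp
  have hμq : μ ^ q = (p - 1) / c := by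
    rw [hμ, ← Real.rpow_mul hr.le, one_div_mul_cancel hq0.ne', Real.rpow_one]
  have hμp : μ ^ p = ((p - 1) / c) ^ (p - 1) := by
    rw [hμ, ← Real.rpow_mul hr.le, ← hqp]; congr 1; ring
  have hyp : (|y| ^ (p - 1)) ^ q = |y| ^ p := by
    rw [← Real.rpow_mul (abs_nonneg _), hpq.sub_one_mul_conj]
  have hY := Real.young_inequality_of_nonneg (a := μ * |z|) (b := |y| ^ (p - 1) * |W| / μ)
    (by positivity) (by positivity) hpq
  rw [Real.mul_rpow hμ0.le (abs_nonneg _), Real.div_rpow (by positivity) hμ0.le,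
    Real.mul_rpow (by positivity) (abs_nonneg _), hyp, hμq, hμp] at hY
  have hY' : p * (|y| ^ (p - 1) * |z| * |W|) ≤
      ((p - 1) / c) ^ (p - 1) * |z| ^ p + c * (|y| ^ p * |W| ^ q) := by
    have h1 : μ * |z| * (|y| ^ (p - 1) * |W| / μ) = |y| ^ (p - 1) * |z| * |W| := by field_simp
    rw [h1] at hY
    calc p * (|y| ^ (p - 1) * |z| * |W|) ≤ p * _ := mul_le_mul_of_nonneg_left hY hp0.le
      _ = ((p - 1) / c) ^ (p - 1) * |z| ^ p +
          (p / q) / (p - 1) * (c * (|y| ^ p * |W| ^ q)) := by field_simp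
      _ = _ := by rw [hqp, div_self hp1.ne', one_mul]
  have habs : |p * |y| ^ (p - 2) * y * z * W| = p * (|y| ^ (p - 1) * |z| * |W|) := by
    rw [abs_mul, abs_mul, abs_mul, abs_mul, abs_of_pos hp0,
      abs_of_nonneg (Real.rpow_nonneg (abs_nonneg y) _)]
    rcases eq_or_ne y 0 with rfl | hy
    · simp [Real.zero_rpow hp1.ne']
    · have : |y| ^ (p - 1) = |y| ^ (p - 2) * |y| := by
        rw [← Real.rpow_add_one (abs_pos.2 hy).ne']; congr 1; ring
      rw [this]; ring
  have := neg_abs_le (p * |y| ^ (p - 2) * y * z * W)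
  rw [habs] at this
  nlinarith

lemma continuous_abs_rpow_mul_self {p : ℝ} (hp : 1 < p) :
    Continuous fun y : ℝ => |y| ^ (p - 2) * y := by
  have hs : ∀ y : ℝ, |y| ^ (p - 2) * y = |y| ^ (p - 1) * SignType.sign y := by
    intro y
    rcases eq_or_ne y 0 with rfl | hy
    · simp
    · rw [show p - 1 = (p - 2) + 1 by ring, Real.rpow_add_one (abs_pos.2 hy).ne', mul_assoc,
        abs_mul_sign]
  rw [continuous_iff_continuousAt]
  intro y
  rcases eq_or_ne y 0 with rfl | hy
  · have h0 : Tendsto (fun y : ℝ => |y| ^ (p - 1)) (𝓝 0) (𝓝 0) := by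
      have : Continuous fun y : ℝ => |y| ^ (p - 1) :=
        continuous_abs.rpow_const fun _ => Or.inr (by linarith)
      simpa [Real.zero_rpow (by linarith : p - 1 ≠ 0)] using this.tendsto 0
    rw [ContinuousAt, mul_zero]
    refine squeeze_zero_norm (fun y => ?_) h0
    rw [hs, norm_mul, Real.norm_of_nonneg (by positivity)]
    refine mul_le_of_le_one_right (by positivity) ?_
    rcases lt_trichotomy y 0 with h | h | h <;> simp [h]
  · exact (continuousAt_id.abs.rpow_const (Or.inl (abs_pos.2 hy).ne')).mul continuousAt_id

lemma exists_riccati_Ioo {p q : ℝ} (hpq : p.HolderConjugate q) {a b : ℝ} (hab : a < b) :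
    ∃ W : ℝ → ℝ,
      (∀ x ∈ Ioo a b, HasDerivAt W ((p - 1) * piP p / (b - a) * (1 + |W x| ^ q)) x) ∧
      ∀ R : ℝ, ∃ x ∈ Ioo a b, W x = R := by
  obtain ⟨w, hw, hsurj⟩ := exists_riccati hpq
  have hπ := piP_pos hpq.lt
  have hba : 0 < b - a := sub_pos.2 hab
  have hp1 : 0 < p - 1 := by linarith [hpq.lt]
  set c := (p - 1) * piP p / (b - a) with hc
  have hc0 : 0 < c := by positivity
  have h1 : c * ((b - a) / 2) = (p - 1) * piP p / 2 := by rw [hc]; field_simp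
  have hmem : ∀ x, c * (x - (a + b) / 2) ∈
      Ioo (-((p - 1) * piP p / 2)) ((p - 1) * piP p / 2) ↔ x ∈ Ioo a b := by
    intro x
    rw [← h1, ← mul_neg, mem_Ioo, mul_lt_mul_iff_right₀ hc0, mul_lt_mul_iff_right₀ hc0]
    constructor <;> rintro ⟨h, h'⟩ <;> constructor <;> linarith
  refine ⟨fun x => w (c * (x - (a + b) / 2)), fun x hx => ?_, fun R => ?_⟩
  · have h2 : HasDerivAt (fun x : ℝ => c * (x - (a + b) / 2)) c x := by
      simpa using ((hasDerivAt_id x).sub_const ((a + b) / 2)).const_mul c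
    exact ((hw _ ((hmem x).2 hx)).comp x h2).congr_deriv (by ring)
  · obtain ⟨y, hy, hyR⟩ := hsurj R
    have h3 : c * ((y / c + (a + b) / 2) - (a + b) / 2) = y := by field_simp; ring
    exact ⟨y / c + (a + b) / 2, (hmem _).1 (by rwa [h3]), by simp only [h3, hyR]⟩

/-- The sharp one-dimensional Poincaré inequality in `L^p`. -/
lemma poincare_Ioo {p : ℝ} (hp : 1 < p) {a b : ℝ} (hab : a < b) {u : ℝ → ℝ}
    (hu : ContDiff ℝ 1 u) (hcs : HasCompactSupport u) (hs : tsupport u ⊆ Ioo a b) :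
    (p - 1) * (piP p / (b - a)) ^ p * ∫ x, |u x| ^ p ≤ ∫ x, |deriv u x| ^ p := by
  have hpq := Real.HolderConjugate.conjExponent hp
  set q := p.conjExponent
  obtain ⟨W, hWd, -⟩ := exists_riccati_Ioo hpq hab
  have hπ := piP_pos hp
  have hba : 0 < b - a := sub_pos.2 hab
  have hp1 : 0 < p - 1 := by linarith
  set c := (p - 1) * piP p / (b - a) with hc
  have hc0 : 0 < c := by positivity
  have hu' : Continuous (deriv u) := hu.continuous_deriv le_rfl
  have hud : ∀ x, HasDerivAt u (deriv u x) x := fun x =>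
    (hu.differentiable one_ne_zero x).hasDerivAt
  set Φ : ℝ → ℝ := fun x => |u x| ^ p * W x with hΦ
  set D : ℝ → ℝ := fun x => p * |u x| ^ (p - 2) * u x * deriv u x * W x +
    |u x| ^ p * (c * (1 + |W x| ^ q)) with hD
  have hzero : ∀ x ∉ tsupport u, ∀ᶠ y in 𝓝 x, u y = 0 := fun x hx => by
    have := notMem_tsupport_iff_eventuallyEq.1 hx
    exact this
  have hΦ0 : ∀ x, u x = 0 → Φ x = 0 := fun x hx => by
    simp [hΦ, hx, Real.zero_rpow (by linarith : p ≠ 0)]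
  have hD0 : ∀ x, u x = 0 → D x = 0 := fun x hx => by
    simp [hD, hx, Real.zero_rpow (by linarith : p ≠ 0)]
  have hΦd : ∀ x, HasDerivAt Φ (D x) x := by
    intro x
    by_cases hx : x ∈ tsupport u
    · refine (((hasDerivAt_abs_rpow (u x) hp).comp x (hud x)).mul (hWd x (hs hx))).congr_deriv ?_
      simp only [hD, Function.comp]
    · have h1 : Φ =ᶠ[𝓝 x] fun _ => (0 : ℝ) := (hzero x hx).mono hΦ0
      rw [hD0 x (hzero x hx).self_of_nhds]
      exact (hasDerivAt_const x (0 : ℝ)).congr_of_eventuallyEq h1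
  have hDc : Continuous D := by
    rw [continuous_iff_continuousAt]
    intro x
    by_cases hx : x ∈ tsupport u
    · have hWc : ContinuousAt W x := (hWd x (hs hx)).continuousAt
      have h1 : ContinuousAt (fun x => |u x| ^ (p - 2) * u x) x :=
        ((continuous_abs_rpow_mul_self hp).comp hu.continuous).continuousAt
      have h2 : ContinuousAt (fun x => |u x| ^ p) x :=
        (hu.continuous.abs.rpow_const fun _ => Or.inr (by linarith)).continuousAt
      have h3 : ContinuousAt (fun x => |W x| ^ q) x :=
        hWc.abs.rpow_const (Or.inr hpq.symm.pos.le)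
      have h4 : ContinuousAt (fun x => p * (|u x| ^ (p - 2) * u x) * deriv u x * W x +
          |u x| ^ p * (c * (1 + |W x| ^ q))) x :=
        (((continuousAt_const.mul h1).mul hu'.continuousAt).mul hWc).add
          (h2.mul (continuousAt_const.mul (continuousAt_const.add h3)))
      refine h4.congr (Eventually.of_forall fun x => ?_)
      simp only [hD]; ring
    · have h1 : D =ᶠ[𝓝 x] fun _ => (0 : ℝ) := (hzero x hx).mono hD0
      exact continuousAt_const.congr h1.symm
  have hΦc : Continuous Φ := continuous_iff_continuousAt.2 fun x => (hΦd x).continuousAt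
  have hsupp : ∀ f : ℝ → ℝ, (∀ x, u x = 0 → f x = 0) → HasCompactSupport f := fun f hf =>
    hcs.mono fun x hx hux => hx (hf x hux)
  have hDi : Integrable D := hDc.integrable_of_hasCompactSupport (hsupp D hD0)
  have hint : ∫ x, D x = 0 := integral_eq_zero_of_hasDerivAt_of_integrable hΦd hDi
    (hΦc.integrable_of_hasCompactSupport (hsupp Φ hΦ0))
  have hui : Integrable fun x => |u x| ^ p :=
    (hu.continuous.abs.rpow_const fun _ => Or.inr (by linarith)).integrable_of_hasCompactSupport
      (hsupp _ fun x hx => by simp [hx, Real.zero_rpow (by linarith : p ≠ 0)])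
  have hu'i : Integrable fun x => |deriv u x| ^ p :=
    (hu'.abs.rpow_const fun _ => Or.inr (by linarith)).integrable_of_hasCompactSupport
      (hcs.deriv.mono fun x hx hux => hx (by simp [hux, Real.zero_rpow (by linarith : p ≠ 0)]))
  set α := ((p - 1) / c) ^ (p - 1) with hα
  have hα0 : 0 < α := Real.rpow_pos_of_pos (by positivity) _
  have hmono : ∫ x, (c * |u x| ^ p - α * |deriv u x| ^ p) ≤ ∫ x, D x :=
    integral_mono ((hui.const_mul c).sub (hu'i.const_mul α)) hDi
      fun x => riccati_young hpq hc0 _ _ _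
  rw [hint, integral_sub (hui.const_mul c) (hu'i.const_mul α), integral_const_mul,
    integral_const_mul] at hmono
  have hcα : (p - 1) * (piP p / (b - a)) ^ p = c / α := by
    have h1 : piP p / (b - a) = c / (p - 1) := by rw [hc]; field_simp
    have h2 : (p - 1) / c = (c / (p - 1))⁻¹ := by rw [inv_div]
    have h3 : 0 < c / (p - 1) := by positivity
    rw [h1, hα, h2, Real.inv_rpow h3.le, div_inv_eq_mul, Real.rpow_sub_one h3.ne']
    field_simp
  rw [hcα, div_mul_eq_mul_div, div_le_iff₀ hα0]
  linarith

/-- Smooth compactly supported approximation of a primitive of a bounded function. -/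
lemma exists_smooth_approx_primitive {p : ℝ} (hp : 0 < p) {a a' b' b M : ℝ} (ha : a < a')
    (hab : a' ≤ b') (hb : b' < b) {g : ℝ → ℝ} (hg : Integrable g) (hM : ∀ x, |g x| ≤ M)
    (hg0 : ∀ x ∉ Icc a' b', g x = 0) (hgint : ∫ x, g x = 0) :
    ∃ ψ : ℕ → ℝ → ℝ,
      (∀ n, ContDiff ℝ (⊤ : ℕ∞) (ψ n) ∧ HasCompactSupport (ψ n) ∧ tsupport (ψ n) ⊆ Ioo a b) ∧
      Tendsto (fun n => ∫ x, |ψ n x| ^ p) atTop (𝓝 (∫ x, |∫ t in a..x, g t| ^ p)) ∧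
      Tendsto (fun n => ∫ x, |deriv (ψ n) x| ^ p) atTop (𝓝 (∫ x, |g x| ^ p)) := by
  have hM0 : 0 ≤ M := (abs_nonneg _).trans (hM 0)
  set r := min (a' - a) (b - b') / 2 with hr
  have hr0 : 0 < r := half_pos (lt_min (by linarith) (by linarith))
  have hra : a < a' - r := by
    have := min_le_left (a' - a) (b - b'); linarith
  have hrb : b' + r < b := by
    have := min_le_right (a' - a) (b - b'); linarith
  set ρ : ℕ → ℝ := fun n => r * (1 / ((n : ℝ) + 1)) with hρ
  have hρ0 : ∀ n, 0 < ρ n := fun n => by positivity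
  have hρr : ∀ n, ρ n ≤ r := fun n => by
    refine mul_le_of_le_one_right hr0.le ?_
    rw [div_le_one (by positivity)]
    linarith [(Nat.cast_nonneg n : (0 : ℝ) ≤ n)]
  have hρlim : Tendsto ρ atTop (𝓝 0) := by
    simpa [hρ] using (tendsto_one_div_add_atTop_nhds_zero_nat (𝕜 := ℝ)).const_mul r
  let φ : ℕ → ContDiffBump (0 : ℝ) := fun n =>
    { rIn := ρ n / 2, rOut := ρ n, rIn_pos := half_pos (hρ0 n), rIn_lt_rOut := half_lt_self (hρ0 n) }
  set γ : ℕ → ℝ → ℝ := fun n =>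
    convolution ((φ n).normed volume) g (ContinuousLinearMap.lsmul ℝ ℝ) volume with hγ
  have hγsmooth : ∀ n, ContDiff ℝ (⊤ : ℕ∞) (γ n) := fun n =>
    (φ n).hasCompactSupport_normed.contDiff_convolution_left _ (φ n).contDiff_normed
      hg.locallyIntegrable
  have hγM : ∀ n x, |γ n x| ≤ M := by
    intro n x
    have h1 : ∫ t, (φ n).normed volume t * M = M := by
      rw [integral_mul_const, (φ n).integral_normed, one_mul]
    rw [← h1, ← Real.norm_eq_abs]
    refine norm_integral_le_of_norm_le ((φ n).integrable_normed.mul_const M)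
      (Eventually.of_forall fun t => ?_)
    simp only [ContinuousLinearMap.lsmul_apply, smul_eq_mul, norm_mul]
    rw [Real.norm_of_nonneg ((φ n).nonneg_normed t)]
    exact mul_le_mul_of_nonneg_left (hM _) ((φ n).nonneg_normed t)
  have hγ0 : ∀ n, ∀ x ∉ Icc (a' - r) (b' + r), γ n x = 0 := by
    intro n x hx
    by_contra hne
    obtain ⟨y, hy, z, hz, rfl⟩ := support_convolution_subset
      (ContinuousLinearMap.lsmul ℝ ℝ) (show x ∈ Function.support (γ n) from hne)
    have hz' : z ∈ Icc a' b' := by by_contra h; exact hz (hg0 z h)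
    rw [(φ n).support_normed_eq, Metric.mem_ball, dist_zero_right, Real.norm_eq_abs] at hy
    have hy' : |y| < r := hy.trans_le (hρr n)
    rw [abs_lt] at hy'
    exact hx ⟨by linarith [hz'.1, hy'.1], by linarith [hz'.2, hy'.2]⟩
  have hγcs : ∀ n, HasCompactSupport (γ n) := fun n =>
    HasCompactSupport.intro isCompact_Icc (hγ0 n)
  have hγi : ∀ n, Integrable (γ n) := fun n =>
    (hγsmooth n).continuous.integrable_of_hasCompactSupport (hγcs n)
  have hγint : ∀ n, ∫ x, γ n x = 0 := fun n => by
    rw [hγ]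
    simp only
    rw [integral_convolution _ (φ n).integrable_normed hg, hgint, map_zero]
  have hγlim : ∀ᵐ x, Tendsto (fun n => γ n x) atTop (𝓝 (g x)) :=
    ContDiffBump.ae_convolution_tendsto_right_of_locallyIntegrable (K := 2) hρlim
      (Eventually.of_forall fun n => by
        change ρ n ≤ 2 * (ρ n / 2)
        linarith) hg.locallyIntegrable
  set ψ : ℕ → ℝ → ℝ := fun n x => ∫ t in a..x, γ n t with hψ
  have hψd : ∀ n x, HasDerivAt (ψ n) (γ n x) x := fun n x =>
    intervalIntegral.integral_hasDerivAt_right ((hγi n).intervalIntegrable)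
      (hγsmooth n).continuous.aestronglyMeasurable.stronglyMeasurableAtFilter
      (hγsmooth n).continuous.continuousAt
  have hψderiv : ∀ n, deriv (ψ n) = γ n := fun n => funext fun x => (hψd n x).deriv
  have hψ0 : ∀ n, ∀ x ∉ Icc (a' - r) (b' + r), ψ n x = 0 := by
    intro n x hx
    simp only [hψ]
    rcases lt_or_ge x (a' - r) with h | h
    · refine intervalIntegral.integral_zero_ae (Eventually.of_forall fun t ht => hγ0 n t ?_)
      rintro ⟨ht1, -⟩
      have := ht.2
      rcases max_cases a x with hm | hm <;> linarith
    · have hx2 : b' + r < x := by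
        by_contra hh; exact hx ⟨h, not_lt.1 hh⟩
      rw [intervalIntegral.integral_of_le (by linarith), ← hγint n]
      refine setIntegral_eq_integral_of_forall_compl_eq_zero fun t ht => hγ0 n t ?_
      rintro ⟨ht1, ht2⟩
      exact ht ⟨by linarith, by linarith⟩
  have hψbd : ∀ n x, |ψ n x| ≤ (Icc a b).indicator (fun _ => M * (b - a)) x := by
    intro n x
    by_cases hx : x ∈ Icc a b
    · rw [indicator_of_mem hx]
      have := intervalIntegral.norm_integral_le_of_norm_le_const (a := a) (b := x) (f := γ n)
        (C := M) fun t _ => hγM n t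
      refine this.trans (mul_le_mul_of_nonneg_left ?_ hM0)
      rw [abs_of_nonneg (by linarith [hx.1])]
      linarith [hx.2]
    · rw [indicator_of_notMem hx, hψ0 n x, abs_zero]
      exact fun h => hx ⟨by linarith [h.1], by linarith [h.2]⟩
  have hψlim : ∀ x, Tendsto (fun n => ψ n x) atTop (𝓝 (∫ t in a..x, g t)) := by
    intro x
    refine intervalIntegral.tendsto_integral_filter_of_dominated_convergence (fun _ => M)
      (Eventually.of_forall fun n => (hγsmooth n).continuous.aestronglyMeasurable)
      (Eventually.of_forall fun n => Eventually.of_forall fun t _ => hγM n t)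
      intervalIntegrable_const ?_
    filter_upwards [hγlim] with t ht _ using ht
  have hpow : Continuous fun y : ℝ => |y| ^ p :=
    continuous_abs.rpow_const fun _ => Or.inr hp.le
  have hψs : ∀ n, ContDiff ℝ (⊤ : ℕ∞) (ψ n) := fun n => by
    refine contDiff_infty_iff_deriv.2 ⟨fun x => (hψd n x).differentiableAt, ?_⟩
    rw [hψderiv]; exact hγsmooth n
  have hindi : ∀ C : ℝ, Integrable ((Icc a b).indicator fun _ => C) := fun C =>
    (integrable_indicator_iff measurableSet_Icc).2 (by simp)
  refine ⟨ψ, fun n => ⟨hψs n, HasCompactSupport.intro isCompact_Icc (hψ0 n), ?_⟩, ?_, ?_⟩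
  · refine (closure_minimal (fun x hx => ?_) isClosed_Icc).trans
      (Icc_subset_Ioo hra hrb)
    by_contra h
    exact hx (hψ0 n x h)
  · refine tendsto_integral_of_dominated_convergence
      ((Icc a b).indicator fun _ => (M * (b - a)) ^ p)
      (fun n => (hpow.comp (hψs n).continuous).aestronglyMeasurable) (hindi _)
      (fun n => Eventually.of_forall fun x => ?_)
      (Eventually.of_forall fun x => (hpow.tendsto _).comp (hψlim x))
    rw [Real.norm_of_nonneg (by positivity)]
    refine (Real.rpow_le_rpow (abs_nonneg _) (hψbd n x) hp.le).trans_eq ?_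
    by_cases hx : x ∈ Icc a b <;> simp [hx, Real.zero_rpow hp.ne']
  · simp only [hψderiv]
    refine tendsto_integral_of_dominated_convergence ((Icc a b).indicator fun _ => M ^ p)
      (fun n => (hpow.comp (hγsmooth n).continuous).aestronglyMeasurable) (hindi _)
      (fun n => Eventually.of_forall fun x => ?_)
      (hγlim.mono fun x hx => (hpow.tendsto _).comp hx)
    rw [Real.norm_of_nonneg (by positivity)]
    by_cases hx : x ∈ Icc a b
    · rw [indicator_of_mem hx]
      exact Real.rpow_le_rpow (abs_nonneg _) (hγM n x) hp.le
    · rw [indicator_of_notMem hx, hγ0 n x, abs_zero, Real.zero_rpow hp.ne']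
      exact fun h => hx ⟨by linarith [h.1], by linarith [h.2]⟩

/-- Sharpness of the one-dimensional Poincaré inequality, by smooth functions. -/
lemma exists_near_extremal_Ioo {p : ℝ} (hp : 1 < p) {a b : ℝ} (hab : a < b) {ε : ℝ}
    (hε : 0 < ε) :
    ∃ ψ : ℝ → ℝ, ContDiff ℝ (⊤ : ℕ∞) ψ ∧ HasCompactSupport ψ ∧ tsupport ψ ⊆ Ioo a b ∧
      ∫ x, |ψ x| ^ p = 1 ∧
      ∫ x, |deriv ψ x| ^ p ≤ (p - 1) * (piP p / (b - a)) ^ p + ε := by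
  have hpq := Real.HolderConjugate.conjExponent hp
  set q := p.conjExponent
  have hp0 : 0 < p := hpq.pos
  have hq := hpq.symm.lt
  have hq0 := hpq.symm.pos
  obtain ⟨W, hWd, hWs⟩ := exists_riccati_Ioo hpq hab
  have hπ := piP_pos hp
  have hba : 0 < b - a := sub_pos.2 hab
  have hp1 : 0 < p - 1 := by linarith
  have hcp : piP p / (b - a) = (p - 1) * piP p / (b - a) / (p - 1) := by field_simp
  rw [hcp]
  set c := (p - 1) * piP p / (b - a) with hc
  have hc0 : 0 < c := by positivity
  set lam := (p - 1) * (c / (p - 1)) ^ p with hlam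
  have hlam0 : 0 < lam := by positivity
  have hqp : q / p = (p - 1)⁻¹ := by rw [hpq.conjugate_eq]; field_simp
  have hq1 : q - 1 = (p - 1)⁻¹ := by rw [hpq.conjugate_eq]; field_simp; ring
  have hWc : ContinuousOn W (Ioo a b) := fun x hx => (hWd x hx).continuousAt.continuousWithinAt
  have hWm : StrictMonoOn W (Ioo a b) := by
    refine strictMonoOn_of_deriv_pos (convex_Ioo a b) hWc fun x hx => ?_
    rw [interior_Ioo] at hx
    rw [(hWd x hx).deriv]
    positivity
  set A : ℝ → ℝ := fun x => 1 + |W x| ^ q with hA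
  have hA1 : ∀ x, 1 ≤ A x := fun x => by
    have : 0 ≤ |W x| ^ q := by positivity
    simp only [hA]; linarith
  have hA0 : ∀ x, 0 < A x := fun x => one_pos.trans_le (hA1 x)
  set h : ℝ → ℝ := fun x => A x ^ (-1 / p) with hh
  have hh0 : ∀ x, 0 < h x := fun x => Real.rpow_pos_of_pos (hA0 x) _
  have hh1 : ∀ x, h x ≤ 1 := fun x => Real.rpow_le_one_of_one_le_of_nonpos (hA1 x)
    (by rw [neg_div]; simp [hp0.le])
  have hhp : ∀ x, h x ^ p = (A x)⁻¹ := fun x => by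
    simp only [hh]
    rw [← Real.rpow_mul (hA0 x).le, div_mul_cancel₀ _ hp0.ne', Real.rpow_neg_one]
  have hAd : ∀ x ∈ Ioo a b, HasDerivAt A (q * |W x| ^ (q - 2) * W x * (c * A x)) x :=
    fun x hx => ((hasDerivAt_abs_rpow (W x) hq).comp x (hWd x hx)).const_add 1
  set k : ℝ → ℝ := fun x => -(c / (p - 1)) * (h x * (|W x| ^ (q - 2) * W x)) with hk
  have hhd : ∀ x ∈ Ioo a b, HasDerivAt h (k x) x := by
    intro x hx
    refine ((hAd x hx).rpow_const (p := -1 / p) (Or.inl (hA0 x).ne')).congr_deriv ?_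
    rw [Real.rpow_sub_one (hA0 x).ne']
    simp only [hk, hh]
    have hne := (hA0 x).ne'
    rw [div_eq_mul_inv c, ← hqp]
    field_simp
  have hAc : ContinuousOn A (Ioo a b) := fun x hx => (hAd x hx).continuousAt.continuousWithinAt
  have hhc : ContinuousOn h (Ioo a b) := fun x hx => (hhd x hx).continuousAt.continuousWithinAt
  have hkc : ContinuousOn k (Ioo a b) :=
    continuousOn_const.mul (hhc.mul ((continuous_abs_rpow_mul_self hq).comp_continuousOn hWc))
  have habs : ∀ y : ℝ, |(|y| ^ (q - 2) * y)| = |y| ^ (q - 1) := by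
    intro y
    rw [abs_mul, abs_of_nonneg (Real.rpow_nonneg (abs_nonneg y) _)]
    rcases eq_or_ne y 0 with rfl | hy
    · simp [Real.zero_rpow (by linarith : q - 1 ≠ 0)]
    · rw [← Real.rpow_add_one (abs_pos.2 hy).ne']; congr 1; ring
  have hkp : ∀ x, |k x| ^ p = (c / (p - 1)) ^ p * ((A x)⁻¹ * |W x| ^ q) := by
    intro x
    simp only [hk]
    rw [abs_mul, abs_neg, abs_mul, habs, abs_of_pos (div_pos hc0 hp1), abs_of_pos (hh0 x),
      Real.mul_rpow (by positivity) (mul_nonneg (hh0 x).le (by positivity)),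
      Real.mul_rpow (hh0 x).le (by positivity), hhp, ← Real.rpow_mul (abs_nonneg _),
      hpq.symm.sub_one_mul_conj]
  -- the energy of `h` on an interval where `W` goes from `-R` to `R`
  have henergy : ∀ x₁ ∈ Ioo a b, ∀ x₂ ∈ Ioo a b, x₁ ≤ x₂ → 0 ≤ W x₂ → W x₁ = -W x₂ →
      ∫ x in x₁..x₂, |k x| ^ p ≤ lam * ∫ x in x₁..x₂, (A x)⁻¹ := by
    intro x₁ h₁ x₂ h₂ h12 hpos hneg
    have hsub : Icc x₁ x₂ ⊆ Ioo a b := Icc_subset_Ioo h₁.1 h₂.2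
    have hsub' : uIcc x₁ x₂ ⊆ Ioo a b := by rwa [uIcc_of_le h12]
    have hAi : ContinuousOn (fun x => (A x)⁻¹) (uIcc x₁ x₂) :=
      (hAc.mono hsub').inv₀ fun x _ => (hA0 x).ne'
    have hAWi : ContinuousOn (fun x => (A x)⁻¹ * |W x| ^ q) (uIcc x₁ x₂) :=
      hAi.mul ((hWc.mono hsub').abs.rpow_const fun _ _ => Or.inr hq0.le)
    have hG : ∀ x ∈ uIcc x₁ x₂, HasDerivAt (fun x => W x * (A x)⁻¹)
        (c * (A x)⁻¹ - c * (p - 1)⁻¹ * ((A x)⁻¹ * |W x| ^ q)) x := by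
      intro x hx
      refine ((hWd x (hsub' hx)).mul ((hAd x (hsub' hx)).inv (hA0 x).ne')).congr_deriv ?_
      have hW2 : |W x| ^ (q - 2) * W x * W x = |W x| ^ q := by
        rcases eq_or_ne (W x) 0 with h0 | h0
        · simp [h0, Real.zero_rpow hq0.ne']
        · rw [mul_assoc, ← abs_mul_abs_self, ← mul_assoc,
            ← Real.rpow_add_one (abs_pos.2 h0).ne', ← Real.rpow_add_one (abs_pos.2 h0).ne']
          congr 1; ring
      have hAx : 1 + |W x| ^ q = A x := rfl
      have hne := (hA0 x).ne'
      simp only [Pi.inv_apply]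
      rw [hAx, ← hq1]
      calc _ = c - c * q * (|W x| ^ (q - 2) * W x * W x) * (A x)⁻¹ := by field_simp; ring
        _ = c * A x * (A x)⁻¹ - c * q * |W x| ^ q * (A x)⁻¹ := by rw [hW2]; field_simp
        _ = _ := by rw [← hAx]; ring
    have hftc := intervalIntegral.integral_eq_sub_of_hasDerivAt hG
      ((hAi.intervalIntegrable.const_mul c).sub
        (hAWi.intervalIntegrable.const_mul (c * (p - 1)⁻¹)))
    rw [intervalIntegral.integral_sub (hAi.intervalIntegrable.const_mul c)
      (hAWi.intervalIntegrable.const_mul _), intervalIntegral.integral_const_mul,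
      intervalIntegral.integral_const_mul] at hftc
    have hGpos : 0 ≤ W x₂ * (A x₂)⁻¹ - W x₁ * (A x₁)⁻¹ := by
      have := (hA0 x₁).le
      have := (hA0 x₂).le
      rw [hneg]
      have h1 : 0 ≤ W x₂ * (A x₂)⁻¹ := by positivity
      have h2 : 0 ≤ W x₂ * (A x₁)⁻¹ := by positivity
      linarith
    rw [← hftc] at hGpos
    have hle : ∫ x in x₁..x₂, (A x)⁻¹ * |W x| ^ q ≤ (p - 1) * ∫ x in x₁..x₂, (A x)⁻¹ := by
      have h1 : 0 ≤ c * ((∫ x in x₁..x₂, (A x)⁻¹) -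
          (p - 1)⁻¹ * ∫ x in x₁..x₂, (A x)⁻¹ * |W x| ^ q) := by linarith
      have h2 := nonneg_of_mul_nonneg_right h1 hc0
      rw [← inv_mul_le_iff₀ hp1]
      linarith
    simp only [hkp]
    rw [intervalIntegral.integral_const_mul, hlam, mul_comm (p - 1), mul_assoc]
    exact mul_le_mul_of_nonneg_left hle (by positivity)
  obtain ⟨y₁, hy₁, hWy₁⟩ := hWs (-1)
  obtain ⟨y₂, hy₂, hWy₂⟩ := hWs 1
  have hy12 : y₁ < y₂ := (hWm.lt_iff_lt hy₁ hy₂).1 (by rw [hWy₁, hWy₂]; norm_num)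
  have hcAinv : ContinuousOn (fun x => (A x)⁻¹) (Ioo a b) :=
    hAc.inv₀ fun x _ => (hA0 x).ne'
  set P₁ := ∫ x in y₁..y₂, (A x)⁻¹ with hP₁
  have hP₁0 : 0 < P₁ := by
    refine intervalIntegral.intervalIntegral_pos_of_pos_on ?_ (fun x _ => inv_pos.2 (hA0 x)) hy12
    exact (hcAinv.mono (by
      rw [uIcc_of_le hy12.le]; exact Icc_subset_Ioo hy₁.1 hy₂.2)).intervalIntegrable
  obtain ⟨R, hR1, hR⟩ : ∃ R : ℝ, 1 ≤ R ∧
      (1 + R ^ q) ^ (-1 / p) * ((lam + ε) * p * (b - a)) < ε * P₁ := by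
    have h1 : Tendsto (fun R : ℝ => (1 + R ^ q) ^ (-1 / p)) atTop (𝓝 0) := by
      have h2 : Tendsto (fun y : ℝ => y ^ (-(1 / p))) atTop (𝓝 0) :=
        tendsto_rpow_neg_atTop (by positivity)
      have h3 : Tendsto (fun R : ℝ => 1 + R ^ q) atTop atTop :=
        tendsto_atTop_add_const_left _ _ (tendsto_rpow_atTop hq0)
      simpa only [neg_div, Function.comp_def] using h2.comp h3
    have h4 := h1.mul_const ((lam + ε) * p * (b - a))
    rw [zero_mul] at h4
    obtain ⟨R, hR, hR'⟩ :=
      ((h4.eventually (gt_mem_nhds (by positivity : 0 < ε * P₁))).and (eventually_ge_atTop 1)).exists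
    exact ⟨R, hR', hR⟩
  obtain ⟨x₁, h₁, hW₁⟩ := hWs (-R)
  obtain ⟨x₂, h₂, hW₂⟩ := hWs R
  have hxy₁ : x₁ ≤ y₁ := (hWm.le_iff_le h₁ hy₁).1 (by rw [hW₁, hWy₁]; linarith)
  have hxy₂ : y₂ ≤ x₂ := (hWm.le_iff_le hy₂ h₂).1 (by rw [hW₂, hWy₂]; linarith)
  have h12 : x₁ ≤ x₂ := by linarith
  have hsub : Icc x₁ x₂ ⊆ Ioo a b := Icc_subset_Ioo h₁.1 h₂.2
  have hsub' : uIcc x₁ x₂ ⊆ Ioo a b := by rwa [uIcc_of_le h12]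
  set δ := (1 + R ^ q) ^ (-1 / p) with hδ
  have hδ0 : 0 < δ := by
    have : 0 < R := by linarith
    positivity
  have hhx₁ : h x₁ = δ := by simp only [hh, hA, hW₁, abs_neg]; rw [abs_of_nonneg (by linarith)]
  have hhx₂ : h x₂ = δ := by simp only [hh, hA, hW₂]; rw [abs_of_nonneg (by linarith)]
  set g : ℝ → ℝ := (Icc x₁ x₂).indicator k with hg
  obtain ⟨M, hM⟩ := isCompact_Icc.exists_bound_of_continuousOn (hkc.mono hsub)
  have hki : IntegrableOn k (Icc x₁ x₂) := (hkc.mono hsub).integrableOn_Icc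
  have hgi : Integrable g := (integrable_indicator_iff measurableSet_Icc).2 hki
  have hgM : ∀ x, |g x| ≤ M := by
    intro x
    by_cases hx : x ∈ Icc x₁ x₂
    · rw [hg, indicator_of_mem hx]; exact hM x hx
    · rw [hg, indicator_of_notMem hx, abs_zero]
      exact (norm_nonneg _).trans (hM x₁ ⟨le_rfl, h12⟩)
  have hg0 : ∀ x ∉ Icc x₁ x₂, g x = 0 := fun x hx => indicator_of_notMem hx _
  have hkint : ∀ x ∈ Icc x₁ x₂, ∫ t in x₁..x, k t = h x - δ := by
    intro x hx
    have hs : uIcc x₁ x ⊆ Ioo a b := by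
      rw [uIcc_of_le hx.1]; exact (Icc_subset_Icc_right hx.2).trans hsub
    rw [intervalIntegral.integral_eq_sub_of_hasDerivAt (fun t ht => hhd t (hs ht))
      (hkc.mono hs).intervalIntegrable, hhx₁]
  have hgint : ∫ x, g x = 0 := by
    rw [hg, integral_indicator measurableSet_Icc, integral_Icc_eq_integral_Ioc,
      ← intervalIntegral.integral_of_le h12, hkint x₂ ⟨h12, le_rfl⟩, hhx₂, sub_self]
  have hf : ∀ x ∈ Icc x₁ x₂, ∫ t in a..x, g t = h x - δ := by
    intro x hx
    rw [← intervalIntegral.integral_add_adjacent_intervals (b := x₁) hgi.intervalIntegrable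
      hgi.intervalIntegrable, ← hkint x hx]
    have e1 : ∫ t in a..x₁, g t = 0 := by
      rw [intervalIntegral.integral_of_le h₁.1.le, integral_Ioc_eq_integral_Ioo]
      refine setIntegral_eq_zero_of_forall_eq_zero fun t ht => hg0 t fun h => ?_
      exact absurd h.1 (not_le.2 ht.2)
    rw [e1, zero_add]
    refine intervalIntegral.integral_congr fun t ht => ?_
    rw [uIcc_of_le hx.1] at ht
    exact indicator_of_mem (show t ∈ Icc x₁ x₂ from ⟨ht.1, ht.2.trans hx.2⟩) _
  obtain ⟨ψ, hψ, hψ1, hψ2⟩ := exists_smooth_approx_primitive hp0 h₁.1 h12 h₂.2 hgi hgM hg0 hgint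
  set P := ∫ x in x₁..x₂, (A x)⁻¹ with hP
  have hAint : IntervalIntegrable (fun x => (A x)⁻¹) volume x₁ x₂ :=
    (hcAinv.mono hsub').intervalIntegrable
  have hPP : P₁ ≤ P :=
    intervalIntegral.integral_mono_interval hxy₁ hy12.le hxy₂
      (Eventually.of_forall fun x => (inv_pos.2 (hA0 x)).le) hAint
  have hgp : ∫ x, |g x| ^ p ≤ lam * P := by
    have e1 : ∀ x, |g x| ^ p = (Icc x₁ x₂).indicator (fun x => |k x| ^ p) x := by
      intro x
      by_cases hx : x ∈ Icc x₁ x₂ <;> simp [hg, hx, Real.zero_rpow hp0.ne']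
    simp only [e1]
    rw [integral_indicator measurableSet_Icc, integral_Icc_eq_integral_Ioc,
      ← intervalIntegral.integral_of_le h12]
    exact henergy x₁ h₁ x₂ h₂ h12 (by rw [hW₂]; linarith) (by rw [hW₁, hW₂])
  have hbern : ∀ x, (A x)⁻¹ - p * δ ≤ |h x - δ| ^ p := by
    intro x
    rw [← hhp]
    rcases le_or_gt δ (h x) with hle | hlt
    · have h1 := one_add_mul_self_le_rpow_one_add (s := -(δ / h x))
        (by rw [neg_le_neg_iff, div_le_one (hh0 x)]; exact hle) hp.le
      have h2 : |h x - δ| = h x * (1 + -(δ / h x)) := by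
        rw [abs_of_nonneg (by linarith)]; have := (hh0 x).ne'; field_simp; ring
      have h3 : 0 ≤ 1 + -(δ / h x) := by
        have : δ / h x ≤ 1 := (div_le_one (hh0 x)).2 hle
        linarith
      rw [h2, Real.mul_rpow (hh0 x).le h3]
      have h4 := mul_le_mul_of_nonneg_left h1 (Real.rpow_nonneg (hh0 x).le p)
      refine le_trans ?_ h4
      have h5 : h x ^ p = h x ^ (p - 1) * h x := by
        rw [← Real.rpow_add_one (hh0 x).ne']; congr 1; ring
      have h6 : h x ^ (p - 1) ≤ 1 := Real.rpow_le_one (hh0 x).le (hh1 x) hp1.le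
      have h7 : h x ^ p * (1 + p * -(δ / h x)) = h x ^ p - h x ^ (p - 1) * (p * δ) := by
        rw [mul_add, mul_one, sub_eq_add_neg]
        congr 1
        have := (hh0 x).ne'
        rw [h5]; field_simp
      rw [h7]
      have : h x ^ (p - 1) * (p * δ) ≤ 1 * (p * δ) :=
        mul_le_mul_of_nonneg_right h6 (by positivity)
      linarith
    · have h1 : h x ^ p ≤ h x := by
        simpa using Real.rpow_le_rpow_of_exponent_ge (hh0 x) (hh1 x) hp.le
      have h2 : δ ≤ p * δ := le_mul_of_one_le_left hδ0.le hp.le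
      have h3 : 0 ≤ |h x - δ| ^ p := by positivity
      linarith
  set f : ℝ → ℝ := fun x => ∫ t in a..x, g t with hfdef
  have hfp : P - p * δ * (b - a) ≤ ∫ x, |f x| ^ p := by
    have hfc : Continuous f := intervalIntegral.continuous_primitive
      (fun _ _ => hgi.intervalIntegrable) a
    have hf0 : ∀ x ∉ Icc x₁ x₂, f x = 0 := by
      intro x hx
      simp only [hfdef]
      rcases lt_or_ge x x₁ with hlt | hge
      · refine intervalIntegral.integral_zero_ae (Eventually.of_forall fun t ht => hg0 t ?_)
        rintro ⟨ht1, -⟩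
        have := ht.2
        rcases max_cases a x with hm | hm <;> linarith [h₁.1]
      · have hx2 : x₂ < x := by
          by_contra hh; exact hx ⟨hge, not_lt.1 hh⟩
        rw [intervalIntegral.integral_of_le (by linarith [h₁.1]), ← hgint]
        refine setIntegral_eq_integral_of_forall_compl_eq_zero fun t ht => hg0 t ?_
        rintro ⟨ht1, ht2⟩
        exact ht ⟨by linarith [h₁.1], by linarith⟩
    have hfpc : Continuous fun x => |f x| ^ p :=
      hfc.abs.rpow_const fun _ => Or.inr hp0.le
    have e1 : ∫ x, |f x| ^ p = ∫ x in x₁..x₂, |f x| ^ p := by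
      rw [intervalIntegral.integral_of_le h12, ← integral_Icc_eq_integral_Ioc]
      refine (setIntegral_eq_integral_of_forall_compl_eq_zero fun x hx => ?_).symm
      rw [hf0 x hx, abs_zero, Real.zero_rpow hp0.ne']
    have e2 : ∫ x in x₁..x₂, ((A x)⁻¹ - p * δ) = P - (x₂ - x₁) * (p * δ) := by
      rw [intervalIntegral.integral_sub hAint intervalIntegrable_const,
        intervalIntegral.integral_const, smul_eq_mul]
    have e3 : (x₂ - x₁) * (p * δ) ≤ p * δ * (b - a) := by
      rw [mul_comm]
      exact mul_le_mul_of_nonneg_left (by linarith [h₁.1, h₂.2]) (by positivity)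
    have e4 : ∫ x in x₁..x₂, ((A x)⁻¹ - p * δ) ≤ ∫ x in x₁..x₂, |f x| ^ p := by
      refine intervalIntegral.integral_mono_on h12 (hAint.sub intervalIntegrable_const)
        (hfpc.intervalIntegrable _ _) fun x hx => ?_
      rw [show f x = h x - δ from hf x hx]
      exact hbern x
    rw [e1]; linarith
  have hstrict : ∫ x, |g x| ^ p < (lam + ε) * ∫ x, |f x| ^ p := by
    have e1 : (lam + ε) * (P - p * δ * (b - a)) ≤ (lam + ε) * ∫ x, |f x| ^ p :=
      mul_le_mul_of_nonneg_left hfp (by positivity)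
    have e2 : ε * P₁ ≤ ε * P := mul_le_mul_of_nonneg_left hPP hε.le
    nlinarith
  obtain ⟨n, hn⟩ := ((hψ2.eventually_lt (hψ1.const_mul (lam + ε))) hstrict).exists
  obtain ⟨hs1, hs2, hs3⟩ := hψ n
  have hd0 : 0 ≤ ∫ x, |deriv (ψ n) x| ^ p := integral_nonneg fun x => by positivity
  set N := ∫ x, |ψ n x| ^ p with hN
  have hN0 : 0 < N := (pos_iff_pos_of_mul_pos (hd0.trans_lt hn)).1 (by positivity)
  set s := N ^ (-1 / p) with hs
  have hs0 : 0 < s := Real.rpow_pos_of_pos hN0 _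
  have hsp : s ^ p = N⁻¹ := by
    rw [hs, ← Real.rpow_mul hN0.le, div_mul_cancel₀ _ hp0.ne', Real.rpow_neg_one]
  have hscale : ∀ y : ℝ, |s * y| ^ p = N⁻¹ * |y| ^ p := fun y => by
    rw [abs_mul, abs_of_pos hs0, Real.mul_rpow hs0.le (abs_nonneg _), hsp]
  refine ⟨fun x => s * ψ n x, contDiff_const.mul hs1, hs2.mul_left, ?_, ?_, ?_⟩
  · refine (closure_mono fun x hx => ?_).trans hs3
    exact right_ne_zero_of_mul hx
  · simp only [hscale]
    rw [integral_const_mul, inv_mul_cancel₀ hN0.ne']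
  · have : ∀ x, deriv (fun x => s * ψ n x) x = s * deriv (ψ n) x := fun x =>
      deriv_const_mul_field s
    simp only [this, hscale]
    rw [integral_const_mul, inv_mul_le_iff₀ hN0]
    linarith

lemma integrable_abs_rpow_of_hasCompactSupport {X : Type*} [TopologicalSpace X]
    [MeasurableSpace X] [OpensMeasurableSpace X] {μ : Measure X} [IsFiniteMeasureOnCompacts μ]
    {f : X → ℝ} (hf : Continuous f) (hcs : HasCompactSupport f) {p : ℝ} (hp : 0 < p) :
    Integrable (fun x => |f x| ^ p) μ :=
  (hf.abs.rpow_const fun _ => Or.inr hp.le).integrable_of_hasCompactSupport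
    (hcs.comp_left (g := fun y : ℝ => |y| ^ p) (by simp [hp.ne']))

namespace IsTestFun

variable {n : ℕ} {D : Set (Fin n → ℝ)} {u : (Fin n → ℝ) → ℝ}

lemma continuous (h : IsTestFun D u) : Continuous u := h.1.continuous

lemma differentiable (h : IsTestFun D u) : Differentiable ℝ u := h.1.differentiable (by simp)

lemma continuous_pder (h : IsTestFun D u) (i : Fin n) : Continuous (pder i u) :=
  (h.1.continuous_fderiv (by simp)).clm_apply continuous_const

lemma hasCompactSupport_pder (h : IsTestFun D u) (i : Fin n) : HasCompactSupport (pder i u) :=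
  h.2.1.fderiv_apply (𝕜 := ℝ) (v := Pi.single i 1)

end IsTestFun

lemma hasDerivAt_comp_update {n : ℕ} {u : (Fin n → ℝ) → ℝ} (hu : Differentiable ℝ u)
    (x : Fin n → ℝ) (i : Fin n) (t : ℝ) :
    HasDerivAt (fun s => u (Function.update x i s)) (pder i u (Function.update x i t)) t :=
  (hu _).hasFDerivAt.comp_hasDerivAt t (hasDerivAt_update x i t)

lemma lintegral_le_of_forall_slice_le {n : ℕ} {f g : (Fin n → ℝ) → ℝ≥0∞}
    (hf : Measurable f) (hg : Measurable g) (i : Fin n)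
    (h : ∀ x, ∫⁻ t, f (Function.update x i t) ≤ ∫⁻ t, g (Function.update x i t)) :
    ∫⁻ x, f x ≤ ∫⁻ x, g x := by
  rw [volume_pi]
  refine lintegral_le_of_lmarginal_le {i} hf hg ?_
  rw [lmarginal_singleton, lmarginal_singleton]
  exact h

lemma integral_le_of_forall_slice_le {n : ℕ} {f g : (Fin n → ℝ) → ℝ}
    (hf : Continuous f) (hg : Continuous g) (hf0 : ∀ x, 0 ≤ f x) (hg0 : ∀ x, 0 ≤ g x)
    (hfi : Integrable f) (hgi : Integrable g) (i : Fin n)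
    (hfs : ∀ x, Integrable fun t => f (Function.update x i t))
    (hgs : ∀ x, Integrable fun t => g (Function.update x i t))
    (h : ∀ x, ∫ t, f (Function.update x i t) ≤ ∫ t, g (Function.update x i t)) :
    ∫ x, f x ≤ ∫ x, g x := by
  rw [← ENNReal.ofReal_le_ofReal_iff (integral_nonneg hg0),
    ofReal_integral_eq_lintegral_ofReal hfi (ae_of_all _ hf0),
    ofReal_integral_eq_lintegral_ofReal hgi (ae_of_all _ hg0)]
  refine lintegral_le_of_forall_slice_le hf.measurable.ennreal_ofReal
    hg.measurable.ennreal_ofReal i fun x => ?_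
  rw [← ofReal_integral_eq_lintegral_ofReal (hfs x) (ae_of_all _ fun t => hf0 _),
    ← ofReal_integral_eq_lintegral_ofReal (hgs x) (ae_of_all _ fun t => hg0 _)]
  exact ENNReal.ofReal_le_ofReal (h x)

lemma HasCompactSupport.comp_update {n : ℕ} {f : (Fin n → ℝ) → ℝ} (hf : HasCompactSupport f)
    (x : Fin n → ℝ) (i : Fin n) : HasCompactSupport fun t => f (Function.update x i t) := by
  refine HasCompactSupport.intro (hf.isCompact.image (continuous_apply i)) fun t ht => ?_
  refine image_eq_zero_of_notMem_tsupport fun hmem => ht ⟨_, hmem, ?_⟩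
  simp

lemma poincare_stripDomain {n k : ℕ} {p : ℝ} (hp : 1 < p) {a b : Fin n → ℝ}
    {u : (Fin n → ℝ) → ℝ} (hu : IsTestFun (stripDomain n k a b) u) {i : Fin n}
    (hi : k ≤ (i : ℕ)) (hab : a i < b i) :
    (p - 1) * (piP p / (b i - a i)) ^ p * ∫ x, |u x| ^ p ≤ ∫ x, |pder i u x| ^ p := by
  have hp0 : 0 < p := by linarith
  have hup : ∀ x : Fin n → ℝ, Continuous (Function.update x i) := fun x =>
    continuous_const.update i continuous_id
  have hpi := piP_pos hp
  have hba : 0 < b i - a i := by linarith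
  have hc : 0 ≤ (p - 1) * (piP p / (b i - a i)) ^ p :=
    mul_nonneg (by linarith) (by positivity)
  rw [← integral_const_mul]
  refine integral_le_of_forall_slice_le ?_ ?_ (fun x => by positivity) (fun x => by positivity)
    ?_ ?_ i (fun x => ?_) (fun x => ?_) fun x => ?_
  · exact (hu.continuous.abs.rpow_const fun _ => Or.inr hp0.le).const_mul _
  · exact (hu.continuous_pder i).abs.rpow_const fun _ => Or.inr hp0.le
  · exact (integrable_abs_rpow_of_hasCompactSupport hu.continuous hu.2.1 hp0).const_mul _
  · exact integrable_abs_rpow_of_hasCompactSupport (hu.continuous_pder i)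
      (hu.hasCompactSupport_pder i) hp0
  · exact (integrable_abs_rpow_of_hasCompactSupport (hu.continuous.comp (hup x))
      (hu.2.1.comp_update x i) hp0).const_mul _
  · exact integrable_abs_rpow_of_hasCompactSupport ((hu.continuous_pder i).comp (hup x))
      ((hu.hasCompactSupport_pder i).comp_update x i) hp0
  · rw [integral_const_mul]
    have hd : deriv (fun t => u (Function.update x i t)) =
        fun t => pder i u (Function.update x i t) :=
      funext fun t => (hasDerivAt_comp_update hu.differentiable x i t).deriv
    have hsub : tsupport (fun t => u (Function.update x i t)) ⊆ Ioo (a i) (b i) := by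
      intro t ht
      have := hu.2.2 (tsupport_comp_subset_preimage u (hup x) ht) i hi
      simpa using this
    have key := poincare_Ioo (u := fun t => u (Function.update x i t)) hp hab
      ((hu.1.of_le (by simp)).comp (contDiff_update 1 x i)) (hu.2.1.comp_update x i) hsub
    rwa [hd] at key

section ProdFun

variable {n : ℕ} {ψ : Fin n → ℝ → ℝ}

lemma tsupport_prod_apply_subset :
    tsupport (fun x : Fin n → ℝ => ∏ i, ψ i (x i)) ⊆ univ.pi fun i => tsupport (ψ i) := by
  refine closure_minimal (fun x hx i _ => subset_tsupport _ fun h => hx ?_)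
    (isClosed_set_pi fun i _ => isClosed_tsupport _)
  exact Finset.prod_eq_zero (Finset.mem_univ i) h

lemma hasCompactSupport_prod_apply (hψ : ∀ i, HasCompactSupport (ψ i)) :
    HasCompactSupport (fun x : Fin n → ℝ => ∏ i, ψ i (x i)) :=
  (isCompact_univ_pi fun i => hψ i).of_isClosed_subset (isClosed_tsupport _)
    tsupport_prod_apply_subset

lemma contDiff_prod_apply (hψ : ∀ i, ContDiff ℝ (⊤ : ℕ∞) (ψ i)) :
    ContDiff ℝ (⊤ : ℕ∞) (fun x : Fin n → ℝ => ∏ i, ψ i (x i)) :=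
  contDiff_prod fun i _ => (hψ i).comp (contDiff_apply ℝ ℝ i)

lemma pder_prod_apply (hψ : ∀ i, ContDiff ℝ (⊤ : ℕ∞) (ψ i)) (i : Fin n) (x : Fin n → ℝ) :
    pder i (fun x : Fin n → ℝ => ∏ j, ψ j (x j)) x =
      ∏ j, Function.update ψ i (deriv (ψ i)) j (x j) := by
  have h1 := hasDerivAt_comp_update ((contDiff_prod_apply hψ).differentiable (by simp)) x i (x i)
  rw [Function.update_eq_self] at h1
  have h2 : ∀ t, ∏ j, ψ j (Function.update x i t j) =
      ψ i t * ∏ j ∈ Finset.univ.erase i, ψ j (x j) := fun t => by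
    rw [← Finset.mul_prod_erase _ _ (Finset.mem_univ i), Function.update_self]
    congr 1
    exact Finset.prod_congr rfl fun j hj => by
      rw [Function.update_of_ne (Finset.ne_of_mem_erase hj)]
  simp only [h2] at h1
  have h3 := (((hψ i).differentiable (by simp)) (x i)).hasDerivAt.mul_const
    (∏ j ∈ Finset.univ.erase i, ψ j (x j))
  rw [h1.unique h3, ← Finset.mul_prod_erase _ _ (Finset.mem_univ i), Function.update_self]
  congr 1
  exact Finset.prod_congr rfl fun j hj => by
    rw [Function.update_of_ne (Finset.ne_of_mem_erase hj)]

lemma integral_abs_prod_apply_rpow (p : ℝ) :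
    ∫ x : Fin n → ℝ, |∏ i, ψ i (x i)| ^ p = ∏ i, ∫ t, |ψ i t| ^ p := by
  rw [← integral_fintype_prod_volume_eq_prod (fun i t => |ψ i t| ^ p)]
  refine integral_congr_ae (ae_of_all _ fun x => ?_)
  simp only
  rw [Finset.abs_prod, Real.finsetProd_rpow _ _ fun i _ => abs_nonneg _]

lemma integral_abs_pder_prod_apply_rpow (hψ : ∀ i, ContDiff ℝ (⊤ : ℕ∞) (ψ i)) {p : ℝ}
    (hψ1 : ∀ i, ∫ t, |ψ i t| ^ p = 1) (i : Fin n) :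
    ∫ x : Fin n → ℝ, |pder i (fun x : Fin n → ℝ => ∏ j, ψ j (x j)) x| ^ p =
      ∫ t, |deriv (ψ i) t| ^ p := by
  simp only [pder_prod_apply hψ]
  rw [integral_abs_prod_apply_rpow, ← Finset.mul_prod_erase _ _ (Finset.mem_univ i),
    Function.update_self, Finset.prod_eq_one, mul_one]
  intro j hj
  rw [Function.update_of_ne (Finset.ne_of_mem_erase hj), hψ1]

end ProdFun

lemma exists_length_rpow_le {p : ℝ} (hp : 1 < p) {ε : ℝ} (hε : 0 < ε) :
    ∃ L : ℝ, 0 < L ∧ (p - 1) * (piP p / L) ^ p ≤ ε := by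
  have h : Tendsto (fun L : ℝ => (p - 1) * (piP p / L) ^ p) atTop (𝓝 ((p - 1) * 0 ^ p)) :=
    ((tendsto_const_nhds.div_atTop tendsto_id).rpow_const (Or.inr (by linarith))).const_mul _
  rw [Real.zero_rpow (by linarith), mul_zero] at h
  obtain ⟨L, hL, hL0⟩ := ((h.eventually_le_const hε).and (eventually_gt_atTop 0)).exists
  exact ⟨L, hL0, hL⟩

/-- Near-extremal test functions on the strip, arranged with pairwise disjoint supports along
the first (unbounded) coordinate. -/
lemma exists_testFun_family {n k : ℕ} (hk1 : 1 ≤ k) (hk : k < n) {p : ℝ} (hp : 1 < p)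
    {a b : Fin n → ℝ} (hab : ∀ i : Fin n, k ≤ (i : ℕ) → a i < b i) {ε : ℝ} (hε : 0 < ε) :
    ∃ u : ℕ → (Fin n → ℝ) → ℝ, (∀ j, IsTestFun (stripDomain n k a b) (u j)) ∧
      (Pairwise fun j l => Disjoint (tsupport (u j)) (tsupport (u l))) ∧
      (∀ j, ∫ x, |u j x| ^ p = 1) ∧
      ∀ j, ∑ i, ∫ x, |pder i (u j) x| ^ p ≤
        (∑ i ∈ Finset.univ.filter (fun i : Fin n => k ≤ (i : ℕ)),
          (p - 1) * (piP p / (b i - a i)) ^ p) + ε := by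
  have hn : (0 : ℝ) < n := by exact_mod_cast (by omega : 0 < n)
  have hδ : 0 < ε / n / 2 := by positivity
  obtain ⟨L, hL, hLε⟩ := exists_length_rpow_le hp hδ
  have hψ : ∀ (j : ℕ) (i : Fin n), ∃ ψ : ℝ → ℝ, ContDiff ℝ (⊤ : ℕ∞) ψ ∧ HasCompactSupport ψ ∧
      (k ≤ (i : ℕ) → tsupport ψ ⊆ Ioo (a i) (b i)) ∧
      (¬ k ≤ (i : ℕ) → tsupport ψ ⊆ Ioo (j * L) ((j + 1) * L)) ∧
      ∫ x, |ψ x| ^ p = 1 ∧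
      ∫ x, |deriv ψ x| ^ p ≤
        (if k ≤ (i : ℕ) then (p - 1) * (piP p / (b i - a i)) ^ p else 0) + ε / n := by
    intro j i
    by_cases hi : k ≤ (i : ℕ)
    · obtain ⟨ψ, h1, h2, h3, h4, h5⟩ := exists_near_extremal_Ioo hp (hab i hi) hδ
      refine ⟨ψ, h1, h2, fun _ => h3, fun h => absurd hi h, h4, ?_⟩
      rw [if_pos hi]
      linarith
    · obtain ⟨ψ, h1, h2, h3, h4, h5⟩ := exists_near_extremal_Ioo hp
        (show (j : ℝ) * L < (j + 1) * L by linarith) hδ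
      refine ⟨ψ, h1, h2, fun h => absurd h hi, fun _ => h3, h4, ?_⟩
      rw [if_neg hi]
      rw [show ((j : ℝ) + 1) * L - j * L = L by ring] at h5
      linarith
  choose ψ h1 h2 h3 h4 h5 h6 using hψ
  refine ⟨fun j x => ∏ i, ψ j i (x i), fun j => ⟨contDiff_prod_apply (h1 j),
    hasCompactSupport_prod_apply (h2 j), fun x hx i hi =>
      h3 j i hi (tsupport_prod_apply_subset hx i (mem_univ i))⟩, fun j l hjl => ?_, fun j => ?_,
    fun j => ?_⟩
  · refine Set.disjoint_left.2 fun x hx hx' => hjl ?_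
    have h0 : ¬ k ≤ ((⟨0, by omega⟩ : Fin n) : ℕ) := by simp; omega
    have hx1 := h4 j _ h0 (tsupport_prod_apply_subset hx _ (mem_univ _))
    have hx2 := h4 l _ h0 (tsupport_prod_apply_subset hx' _ (mem_univ _))
    have hjl1 : (j : ℝ) < l + 1 := lt_of_mul_lt_mul_right (hx1.1.trans hx2.2) hL.le
    have hlj1 : (l : ℝ) < j + 1 := lt_of_mul_lt_mul_right (hx2.1.trans hx1.2) hL.le
    norm_cast at hjl1 hlj1
    omega
  · rw [integral_abs_prod_apply_rpow]
    exact Finset.prod_eq_one fun i _ => h5 j i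
  · simp only [integral_abs_pder_prod_apply_rpow (h1 j) (h5 j)]
    refine (Finset.sum_le_sum fun i _ => h6 j i).trans_eq ?_
    rw [Finset.sum_add_distrib, Finset.sum_filter]
    simp [mul_div_cancel₀ _ hn.ne']

section LpNorm

variable {α E : Type*} [MeasurableSpace α] {μ : Measure α} [NormedAddCommGroup E] {p : ℝ}

lemma Lp_norm_rpow_eq_integral (hp : 0 < p) (f : Lp E (ENNReal.ofReal p) μ) :
    ‖f‖ ^ p = ∫ x, ‖f x‖ ^ p ∂μ := by
  have h := (Lp.memLp f).eLpNorm_eq_integral_rpow_norm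
    (by simpa using hp) ENNReal.ofReal_ne_top
  rw [ENNReal.toReal_ofReal hp.le] at h
  have h0 : 0 ≤ ∫ x, ‖f x‖ ^ p ∂μ := integral_nonneg fun x => by positivity
  rw [Lp.norm_def, h, ENNReal.toReal_ofReal (by positivity), Real.rpow_inv_rpow h0 hp.ne']

lemma Lp_integrable_norm_rpow (hp : 0 < p) (f : Lp E (ENNReal.ofReal p) μ) :
    Integrable (fun x => ‖f x‖ ^ p) μ := by
  have h := (Lp.memLp f).integrable_norm_rpow (by simpa using hp) ENNReal.ofReal_ne_top
  rwa [ENNReal.toReal_ofReal hp.le] at h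

end LpNorm

lemma PiLp_norm_rpow_eq_sum {ι : Type*} [Fintype ι] {p : ℝ} (hp : 0 < p)
    (v : PiLp (ENNReal.ofReal p) (fun _ : ι => ℝ)) : ‖v‖ ^ p = ∑ i, |v i| ^ p := by
  have h : (ENNReal.ofReal p).toReal = p := ENNReal.toReal_ofReal hp.le
  rw [PiLp.norm_eq_sum (by rwa [h]), h, one_div,
    Real.rpow_inv_rpow (Finset.sum_nonneg fun i _ => by positivity) hp.ne']
  simp

section Jet

variable {n : ℕ} {D : Set (Fin n → ℝ)} {u v : (Fin n → ℝ) → ℝ} {p : ℝ}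

lemma isTestFun_zero (D : Set (Fin n → ℝ)) : IsTestFun D (fun _ => 0) :=
  ⟨contDiff_const, HasCompactSupport.zero, by simp [tsupport]⟩

lemma IsTestFun.add (hu : IsTestFun D u) (hv : IsTestFun D v) : IsTestFun D (u + v) :=
  ⟨hu.1.add hv.1, hu.2.1.add hv.2.1, (tsupport_add u v).trans (union_subset hu.2.2 hv.2.2)⟩

lemma IsTestFun.const_smul (hu : IsTestFun D u) (c : ℝ) : IsTestFun D (c • u) :=
  ⟨hu.1.const_smul c, hu.2.1.mono (Function.support_const_smul_subset c u),
    (tsupport_smul_subset_right (fun _ => c) u).trans hu.2.2⟩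

lemma jet_zero (P : ℝ≥0∞) : jet P (fun _ : Fin n → ℝ => (0 : ℝ)) = 0 := by
  ext x j
  refine Fin.cases ?_ (fun i => ?_) j <;> simp [jet, pder]

lemma jet_add (P : ℝ≥0∞) (hu : Differentiable ℝ u) (hv : Differentiable ℝ v) :
    jet P (u + v) = jet P u + jet P v := by
  ext x j
  refine Fin.cases ?_ (fun i => ?_) j
  · simp [jet]
  · simp [jet, pder, fderiv_add (hu x) (hv x)]

lemma jet_const_smul (P : ℝ≥0∞) (hu : Differentiable ℝ u) (c : ℝ) :
    jet P (c • u) = c • jet P u := by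
  ext x j
  refine Fin.cases ?_ (fun i => ?_) j
  · simp [jet]
  · simp [jet, pder, fderiv_const_smul (hu x) c]

lemma norm_jet_rpow (hp : 0 < p) (u : (Fin n → ℝ) → ℝ) (x : Fin n → ℝ) :
    ‖jet (ENNReal.ofReal p) u x‖ ^ p = |u x| ^ p + ∑ i, |pder i u x| ^ p := by
  rw [PiLp_norm_rpow_eq_sum hp, Fin.sum_univ_succ]
  simp [jet]

lemma IsTestFun.continuous_jet (hu : IsTestFun D u) (P : ℝ≥0∞) : Continuous (jet P u) := by
  refine (PiLp.continuous_toLp P _).comp (continuous_pi fun j => ?_)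
  refine Fin.cases ?_ (fun i => ?_) j
  · simpa using hu.continuous
  · simpa using hu.continuous_pder i

lemma jet_eq_zero_of_notMem_tsupport (P : ℝ≥0∞) {x : Fin n → ℝ} (hx : x ∉ tsupport u) :
    jet P u x = 0 := by
  ext j
  refine Fin.cases ?_ (fun i => ?_) j
  · simpa [jet] using image_eq_zero_of_notMem_tsupport hx
  · have h : fderiv ℝ u x = 0 :=
      image_eq_zero_of_notMem_tsupport fun h => hx (tsupport_fderiv_subset ℝ h)
    simp [jet, pder, h]

lemma IsTestFun.hasCompactSupport_jet (hu : IsTestFun D u) (P : ℝ≥0∞) :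
    HasCompactSupport (jet P u) :=
  HasCompactSupport.intro hu.2.1 fun _ hx => jet_eq_zero_of_notMem_tsupport P hx

lemma IsTestFun.memLp_jet (hu : IsTestFun D u) (P : ℝ≥0∞) [Fact (1 ≤ P)] :
    MemLp (jet P u) P (volume : Measure (Fin n → ℝ)) :=
  (hu.continuous_jet P).memLp_of_hasCompactSupport (hu.hasCompactSupport_jet P)

lemma IsTestFun.integral_norm_jet_rpow (hu : IsTestFun D u) (hp : 0 < p) :
    ∫ x, ‖jet (ENNReal.ofReal p) u x‖ ^ p = (∫ x, |u x| ^ p) + ∑ i, ∫ x, |pder i u x| ^ p := by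
  have hi : ∀ i, Integrable fun x => |pder i u x| ^ p := fun i =>
    integrable_abs_rpow_of_hasCompactSupport (hu.continuous_pder i)
      (hu.hasCompactSupport_pder i) hp
  simp only [norm_jet_rpow hp]
  rw [integral_add (integrable_abs_rpow_of_hasCompactSupport hu.continuous hu.2.1 hp)
    (integrable_finsetSum _ fun i _ => hi i), integral_finsetSum _ fun i _ => hi i]

end Jet

section Embedding

variable {n k : ℕ} {p : ℝ} {a b : Fin n → ℝ} [Fact (1 ≤ ENNReal.ofReal p)]

/-- The space of jets of test functions is a linear subspace. -/
lemma exists_testFun_of_mem_span {P : ℝ≥0∞} [Fact (1 ≤ P)] {D : Set (Fin n → ℝ)} {f : Vsp n P}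
    (hf : f ∈ Submodule.span ℝ {f : Vsp n P | ∃ u : (Fin n → ℝ) → ℝ, IsTestFun D u ∧
      (f : (Fin n → ℝ) → PiLp P (fun _ : Fin (n + 1) => ℝ)) =ᵐ[volume] jet P u}) :
    ∃ u : (Fin n → ℝ) → ℝ, IsTestFun D u ∧
      (f : (Fin n → ℝ) → PiLp P (fun _ : Fin (n + 1) => ℝ)) =ᵐ[volume] jet P u := by
  induction hf using Submodule.span_induction with
  | mem f hf => exact hf
  | zero => exact ⟨_, isTestFun_zero D, by rw [jet_zero]; exact Lp.coeFn_zero _ _ _⟩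
  | add f g _ _ hf hg =>
    obtain ⟨u, hu, hfu⟩ := hf
    obtain ⟨v, hv, hgv⟩ := hg
    refine ⟨u + v, hu.add hv, ?_⟩
    rw [jet_add P hu.differentiable hv.differentiable]
    exact (Lp.coeFn_add f g).trans (hfu.add hgv)
  | smul c f _ hf =>
    obtain ⟨u, hu, hfu⟩ := hf
    refine ⟨c • u, hu.const_smul c, ?_⟩
    rw [jet_const_smul P hu.differentiable]
    exact (Lp.coeFn_smul c f).trans (hfu.const_smul c)

lemma compLpL_proj0_ae_eq {P : ℝ≥0∞} [Fact (1 ≤ P)] (f : Vsp n P) :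
    ((proj0 n P).compLpL P volume f : (Fin n → ℝ) → ℝ) =ᵐ[volume] fun x => f x 0 :=
  ContinuousLinearMap.coeFn_compLpL (proj0 n P) f

lemma norm_compLpL_proj0_le (hp : 1 < p) (hab : ∀ i : Fin n, k ≤ (i : ℕ) → a i < b i)
    {u : (Fin n → ℝ) → ℝ} (hu : IsTestFun (stripDomain n k a b) u) {f : Vsp n (ENNReal.ofReal p)}
    (hf : (f : (Fin n → ℝ) → PiLp (ENNReal.ofReal p) (fun _ : Fin (n + 1) => ℝ)) =ᵐ[volume]
      jet (ENNReal.ofReal p) u) :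
    (1 + ∑ i ∈ Finset.univ.filter (fun i : Fin n => k ≤ (i : ℕ)),
        (p - 1) * (piP p / (b i - a i)) ^ p) *
      ‖(proj0 n (ENNReal.ofReal p)).compLpL (ENNReal.ofReal p) volume f‖ ^ p ≤ ‖f‖ ^ p := by
  have hp0 : 0 < p := by linarith
  rw [Lp_norm_rpow_eq_integral hp0, Lp_norm_rpow_eq_integral hp0]
  have h1 : ∫ x, ‖f x‖ ^ p = (∫ x, |u x| ^ p) + ∑ i, ∫ x, |pder i u x| ^ p := by
    rw [← hu.integral_norm_jet_rpow hp0]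
    exact integral_congr_ae (hf.mono fun x hx => by simp only [hx])
  have h2 : ∫ x, ‖(proj0 n (ENNReal.ofReal p)).compLpL (ENNReal.ofReal p) volume f x‖ ^ p =
      ∫ x, |u x| ^ p := by
    refine integral_congr_ae ?_
    filter_upwards [hf, compLpL_proj0_ae_eq f] with x hx hx'
    rw [hx', hx]
    simp [jet]
  rw [h1, h2, add_mul, one_mul, Finset.sum_mul, Finset.sum_filter]
  gcongr with i
  split_ifs with hi
  · exact poincare_stripDomain hp hu hi (hab i hi)
  · exact integral_nonneg fun x => by positivity

lemma norm_SobolevEmb_le (hp : 1 < p) (hab : ∀ i : Fin n, k ≤ (i : ℕ) → a i < b i) :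
    ‖SobolevEmb (ENNReal.ofReal p) (stripDomain n k a b)‖ ≤
      (1 + ∑ i ∈ Finset.univ.filter (fun i : Fin n => k ≤ (i : ℕ)),
        (p - 1) * (piP p / (b i - a i)) ^ p) ^ (-1 / p) := by
  have hp0 : 0 < p := by linarith
  have hpi := piP_pos hp
  have hpos : 0 < 1 + ∑ i ∈ Finset.univ.filter (fun i : Fin n => k ≤ (i : ℕ)),
      (p - 1) * (piP p / (b i - a i)) ^ p := by
    refine add_pos_of_pos_of_nonneg one_pos (Finset.sum_nonneg fun i hi => ?_)
    have := hab i (Finset.mem_filter.1 hi).2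
    have hba : 0 < b i - a i := by linarith
    exact mul_nonneg (by linarith) (by positivity)
  set c := 1 + ∑ i ∈ Finset.univ.filter (fun i : Fin n => k ≤ (i : ℕ)),
    (p - 1) * (piP p / (b i - a i)) ^ p with hc
  refine ContinuousLinearMap.opNorm_le_bound _ (by positivity) fun f => ?_
  have hclosed : IsClosed {f : Vsp n (ENNReal.ofReal p) |
      ‖(proj0 n (ENNReal.ofReal p)).compLpL (ENNReal.ofReal p) volume f‖ ≤
        c ^ (-1 / p) * ‖f‖} :=
    isClosed_le (ContinuousLinearMap.continuous _).norm (continuous_const.mul continuous_norm)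
  refine closure_minimal (fun g hg => ?_) hclosed f.2
  obtain ⟨u, hu, hgu⟩ := exists_testFun_of_mem_span hg
  have h := norm_compLpL_proj0_le hp hab hu hgu
  rw [← hc] at h
  rw [mem_ofPred_eq, ← Real.rpow_le_rpow_iff (norm_nonneg _) (by positivity) hp0,
    Real.mul_rpow (by positivity) (norm_nonneg _), ← Real.rpow_mul hpos.le,
    div_mul_cancel₀ _ hp0.ne', Real.rpow_neg_one, ← div_eq_inv_mul, le_div_iff₀ hpos, mul_comm]
  exact h

end Embedding

lemma norm_sum_rpow_of_pairwise_eq_zero {ι E : Type*} [Fintype ι] [NormedAddCommGroup E]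
    {p : ℝ} (hp : 0 < p) {v : ι → E} (hv : ∀ j l, j ≠ l → v j = 0 ∨ v l = 0) :
    ‖∑ j, v j‖ ^ p = ∑ j, ‖v j‖ ^ p := by
  by_cases h : ∃ j, v j ≠ 0
  · obtain ⟨j, hj⟩ := h
    have h0 : ∀ l, l ≠ j → v l = 0 := fun l hl => (hv l j hl).resolve_right hj
    rw [Fintype.sum_eq_single j h0, Fintype.sum_eq_single j fun l hl => by
      rw [h0 l hl, norm_zero, Real.zero_rpow hp.ne']]
  · push Not at h
    simp [h, Real.zero_rpow hp.ne']

lemma norm_abs_rpow_mul_self_rpow_conj {p q : ℝ} (hpq : p.HolderConjugate q) (y : ℝ) :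
    ‖|y| ^ (p - 2) * y‖ ^ q = |y| ^ p := by
  rcases eq_or_ne y 0 with rfl | hy
  · simp [Real.zero_rpow hpq.symm.ne_zero, Real.zero_rpow hpq.ne_zero]
  · have hy' : 0 < |y| := abs_pos.2 hy
    rw [norm_mul, Real.norm_of_nonneg (by positivity), Real.norm_eq_abs,
      ← Real.rpow_add_one hy'.ne', ← Real.rpow_mul hy'.le]
    congr 1
    rw [show p - 2 + 1 = p - 1 by ring, hpq.sub_one_mul_conj]

lemma mul_abs_rpow_mul_self {p : ℝ} (hp : 1 < p) (y : ℝ) : y * (|y| ^ (p - 2) * y) = |y| ^ p := by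
  rcases eq_or_ne y 0 with rfl | hy
  · simp [Real.zero_rpow (by linarith : p ≠ 0)]
  · have hy' : 0 < |y| := abs_pos.2 hy
    rw [show y * (|y| ^ (p - 2) * y) = |y| ^ (p - 2) * (y * y) by ring, ← abs_mul_abs_self y,
      ← mul_assoc, ← Real.rpow_add_one hy'.ne', ← Real.rpow_add_one hy'.ne']
    congr 1
    ring

section LowerBound

variable {n : ℕ} {p : ℝ} {D : Set (Fin n → ℝ)} {u : (Fin n → ℝ) → ℝ}

lemma IsTestFun.continuous_dual (hp : 1 < p) (hu : IsTestFun D u) :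
    Continuous fun x => |u x| ^ (p - 2) * u x :=
  (continuous_abs_rpow_mul_self hp).comp hu.continuous

lemma IsTestFun.hasCompactSupport_dual (hu : IsTestFun D u) :
    HasCompactSupport fun x => |u x| ^ (p - 2) * u x :=
  hu.2.1.comp_left (g := fun y : ℝ => |y| ^ (p - 2) * y) (by simp)

lemma IsTestFun.integrable_mul_dual (hp : 1 < p) (hu : IsTestFun D u)
    [Fact (1 ≤ ENNReal.ofReal p)] (f : Lp ℝ (ENNReal.ofReal p) (volume : Measure (Fin n → ℝ))) :
    Integrable fun x => f x * (|u x| ^ (p - 2) * u x) := by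
  have h := ((Lp.memLp f).locallyIntegrable Fact.out).integrable_smul_left_of_hasCompactSupport
    (hu.continuous_dual hp) hu.hasCompactSupport_dual
  simpa only [smul_eq_mul, mul_comm] using h

lemma IsTestFun.abs_integral_mul_dual_rpow_le (hp : 1 < p) (hu : IsTestFun D u)
    (hu1 : ∫ x, |u x| ^ p = 1)
    (f : Lp ℝ (ENNReal.ofReal p) (volume : Measure (Fin n → ℝ))) :
    |∫ x, f x * (|u x| ^ (p - 2) * u x)| ^ p ≤ ∫ x in tsupport u, ‖f x‖ ^ p := by
  have hp0 : 0 < p := by linarith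
  have hpq := Real.HolderConjugate.conjExponent hp
  have hg : MemLp (fun x => |u x| ^ (p - 2) * u x) (ENNReal.ofReal p.conjExponent)
      (volume.restrict (tsupport u)) :=
    ((hu.continuous_dual hp).memLp_of_hasCompactSupport hu.hasCompactSupport_dual).restrict _
  have h0 : ∀ x, x ∉ tsupport u → u x = 0 := fun x hx => image_eq_zero_of_notMem_tsupport hx
  have hg1 : ∫ x in tsupport u, ‖|u x| ^ (p - 2) * u x‖ ^ p.conjExponent = 1 := by
    simp only [norm_abs_rpow_mul_self_rpow_conj hpq]
    rw [setIntegral_eq_integral_of_forall_compl_eq_zero, hu1]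
    intro x hx
    simp [h0 x hx, hp0.ne']
  have h := integral_mul_norm_le_Lp_mul_Lq hpq ((Lp.memLp f).restrict (tsupport u)) hg
  rw [hg1, Real.one_rpow, mul_one] at h
  have h2 : |∫ x, f x * (|u x| ^ (p - 2) * u x)| ≤
      ∫ x in tsupport u, ‖f x‖ * ‖|u x| ^ (p - 2) * u x‖ := by
    rw [← setIntegral_eq_integral_of_forall_compl_eq_zero (s := tsupport u)
      fun x hx => by simp [h0 x hx], ← Real.norm_eq_abs]
    simpa only [norm_mul] using! norm_integral_le_integral_norm (μ := volume.restrict (tsupport u))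
      fun x => f x * (|u x| ^ (p - 2) * u x)
  calc |∫ x, f x * (|u x| ^ (p - 2) * u x)| ^ p
      ≤ ((∫ x in tsupport u, ‖f x‖ ^ p) ^ (1 / p)) ^ p :=
        Real.rpow_le_rpow (abs_nonneg _) (h2.trans h) hp0.le
    _ = ∫ x in tsupport u, ‖f x‖ ^ p := by
        rw [one_div, Real.rpow_inv_rpow (integral_nonneg fun x => by positivity) hp0.ne']

variable {ι : Type} [Fintype ι] {w : ι → (Fin n → ℝ) → ℝ} [Fact (1 ≤ ENNReal.ofReal p)]

/-- Pairing with the dual functions of a disjointly supported normalized family is a contraction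
from `L^p` to `ℓ^p`. -/
lemma exists_contraction_of_disjoint (hp : 1 < p) (hw : ∀ j, IsTestFun D (w j))
    (hd : Pairwise fun j l => Disjoint (tsupport (w j)) (tsupport (w l)))
    (hw1 : ∀ j, ∫ x, |w j x| ^ p = 1) :
    ∃ B : Lp ℝ (ENNReal.ofReal p) (volume : Measure (Fin n → ℝ)) →L[ℝ]
        PiLp (ENNReal.ofReal p) (fun _ : ι => ℝ),
      ‖B‖ ≤ 1 ∧ ∀ f j, B f j = ∫ x, f x * (|w j x| ^ (p - 2) * w j x) := by
  have hp0 : 0 < p := by linarith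
  let B₀ : Lp ℝ (ENNReal.ofReal p) (volume : Measure (Fin n → ℝ)) →ₗ[ℝ]
      PiLp (ENNReal.ofReal p) (fun _ : ι => ℝ) :=
    { toFun := fun f => WithLp.toLp _ fun j => ∫ x, f x * (|w j x| ^ (p - 2) * w j x)
      map_add' := fun f g => by
        ext j
        simp only [PiLp.add_apply]
        rw [← integral_add ((hw j).integrable_mul_dual hp f) ((hw j).integrable_mul_dual hp g)]
        refine integral_congr_ae ((Lp.coeFn_add f g).mono fun x hx => ?_)
        simp only [hx, Pi.add_apply]
        ring
      map_smul' := fun c f => by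
        ext j
        simp only [PiLp.smul_apply, RingHom.id_apply, smul_eq_mul]
        rw [← integral_const_mul]
        refine integral_congr_ae ((Lp.coeFn_smul c f).mono fun x hx => ?_)
        simp only [hx, Pi.smul_apply, smul_eq_mul]
        ring }
  have hB : ∀ f, ‖B₀ f‖ ≤ 1 * ‖f‖ := fun f => by
    rw [one_mul, ← Real.rpow_le_rpow_iff (norm_nonneg _) (norm_nonneg _) hp0,
      PiLp_norm_rpow_eq_sum hp0, Lp_norm_rpow_eq_integral hp0]
    have hi := Lp_integrable_norm_rpow hp0 f
    calc ∑ j, |B₀ f j| ^ p ≤ ∑ j, ∫ x in tsupport (w j), ‖f x‖ ^ p :=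
          Finset.sum_le_sum fun j _ => (hw j).abs_integral_mul_dual_rpow_le hp (hw1 j) f
      _ = ∫ x in ⋃ j, tsupport (w j), ‖f x‖ ^ p :=
          (integral_iUnion_fintype (fun j => (isClosed_tsupport _).measurableSet) hd
            fun j => hi.integrableOn).symm
      _ ≤ ∫ x, ‖f x‖ ^ p := setIntegral_le_integral hi (ae_of_all _ fun x => by positivity)
  exact ⟨B₀.mkContinuous 1 hB, B₀.mkContinuous_norm_le zero_le_one hB, fun f j => rfl⟩

/-- A disjointly supported family of test functions spans a copy of `ℓ^p` in `W_0^{1,p}`. -/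
lemma exists_embedding_of_disjoint (hp : 1 < p) (hw : ∀ j, IsTestFun D (w j))
    (hd : Pairwise fun j l => Disjoint (tsupport (w j)) (tsupport (w l))) {K : ℝ} (hK : 0 ≤ K)
    (hwK : ∀ j, ∫ x, ‖jet (ENNReal.ofReal p) (w j) x‖ ^ p ≤ K) :
    ∃ A : PiLp (ENNReal.ofReal p) (fun _ : ι => ℝ) →L[ℝ] W0sub (ENNReal.ofReal p) D,
      ‖A‖ ≤ K ^ (1 / p) ∧ ∀ c, ((A c : Vsp n (ENNReal.ofReal p)) :
        (Fin n → ℝ) → PiLp (ENNReal.ofReal p) (fun _ : Fin (n + 1) => ℝ)) =ᵐ[volume]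
          fun x => ∑ j, c j • jet (ENNReal.ofReal p) (w j) x := by
  have hp0 : 0 < p := by linarith
  let U : ι → W0sub (ENNReal.ofReal p) D := fun j => ⟨((hw j).memLp_jet _).toLp _,
    Submodule.le_topologicalClosure _ (Submodule.subset_span ⟨w j, hw j, MemLp.coeFn_toLp _⟩)⟩
  let A₀ : PiLp (ENNReal.ofReal p) (fun _ : ι => ℝ) →ₗ[ℝ] W0sub (ENNReal.ofReal p) D :=
    (Fintype.linearCombination ℝ U).comp (WithLp.linearEquiv _ ℝ (ι → ℝ)).toLinearMap
  have hA₀ : ∀ c, ((A₀ c : Vsp n (ENNReal.ofReal p)) :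
        (Fin n → ℝ) → PiLp (ENNReal.ofReal p) (fun _ : Fin (n + 1) => ℝ)) =ᵐ[volume]
          fun x => ∑ j, c j • jet (ENNReal.ofReal p) (w j) x := fun c => by
    have h1 : (A₀ c : Vsp n (ENNReal.ofReal p)) =
        ∑ j, c j • ((hw j).memLp_jet (ENNReal.ofReal p)).toLp _ := by
      simp [A₀, U, Fintype.linearCombination_apply]
    rw [h1]
    refine (Lp.coeFn_fun_finsetSum _ _).trans ?_
    have h2 : ∀ᵐ x : Fin n → ℝ, ∀ j,
        (c j • ((hw j).memLp_jet (ENNReal.ofReal p)).toLp _ : Vsp n (ENNReal.ofReal p)) x =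
          c j • jet (ENNReal.ofReal p) (w j) x := by
      refine ae_all_iff.2 fun j => ?_
      filter_upwards [Lp.coeFn_smul (c j) (((hw j).memLp_jet (ENNReal.ofReal p)).toLp _),
        ((hw j).memLp_jet (ENNReal.ofReal p)).coeFn_toLp] with x hx hx'
      rw [hx, Pi.smul_apply, hx']
    filter_upwards [h2] with x hx
    exact Finset.sum_congr rfl fun j _ => hx j
  have hA : ∀ c, ‖A₀ c‖ ≤ K ^ (1 / p) * ‖c‖ := fun c => by
    rw [← Real.rpow_le_rpow_iff (norm_nonneg _) (by positivity) hp0,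
      Real.mul_rpow (by positivity) (norm_nonneg _), one_div, Real.rpow_inv_rpow hK hp0.ne',
      PiLp_norm_rpow_eq_sum hp0, Submodule.coe_norm, Lp_norm_rpow_eq_integral hp0]
    have hi : ∀ j, Integrable fun x => ‖jet (ENNReal.ofReal p) (w j) x‖ ^ p := fun j =>
      (((hw j).continuous_jet _).norm.rpow_const fun _ => Or.inr hp0.le)
        |>.integrable_of_hasCompactSupport (((hw j).hasCompactSupport_jet _).comp_left
          (g := fun v => ‖v‖ ^ p) (by simp [hp0.ne']))
    have h3 : ∫ x, ‖(A₀ c : Vsp n (ENNReal.ofReal p)) x‖ ^ p =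
        ∫ x, ∑ j, |c j| ^ p * ‖jet (ENNReal.ofReal p) (w j) x‖ ^ p := by
      refine integral_congr_ae ((hA₀ c).mono fun x hx => ?_)
      simp only [hx]
      rw [norm_sum_rpow_of_pairwise_eq_zero hp0]
      · simp only [norm_smul, Real.norm_eq_abs,
          Real.mul_rpow (abs_nonneg _) (norm_nonneg _)]
      · intro j l hjl
        by_cases hx : x ∈ tsupport (w j)
        · right
          rw [jet_eq_zero_of_notMem_tsupport _ (Set.disjoint_left.1 (hd hjl) hx), smul_zero]
        · left
          rw [jet_eq_zero_of_notMem_tsupport _ hx, smul_zero]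
    rw [h3, integral_finsetSum _ fun j _ => (hi j).const_mul _, Finset.mul_sum]
    refine Finset.sum_le_sum fun j _ => ?_
    rw [integral_const_mul, mul_comm]
    exact mul_le_mul_of_nonneg_right (hwK j) (by positivity)
  exact ⟨A₀.mkContinuous _ hA, A₀.mkContinuous_norm_le (by positivity) hA, hA₀⟩

lemma one_le_mul_sNumber (hp : 1 < p) {m : ℕ} (hm : 1 ≤ m) {w : Fin m → (Fin n → ℝ) → ℝ}
    (hw : ∀ j, IsTestFun D (w j))
    (hd : Pairwise fun j l => Disjoint (tsupport (w j)) (tsupport (w l)))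
    (hw1 : ∀ j, ∫ x, |w j x| ^ p = 1) {K : ℝ} (hK : 0 ≤ K)
    (hwK : ∀ j, ∫ x, ‖jet (ENNReal.ofReal p) (w j) x‖ ^ p ≤ K) (σ : StrictSNumber) :
    1 ≤ σ.s (SobolevEmb (ENNReal.ofReal p) D) m * K ^ (1 / p) := by
  obtain ⟨B, hB1, hB⟩ := exists_contraction_of_disjoint hp hw hd hw1
  obtain ⟨A, hA1, hA⟩ := exists_embedding_of_disjoint hp hw hd hK hwK
  have hid : (B.comp (SobolevEmb (ENNReal.ofReal p) D)).comp A =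
      ContinuousLinearMap.id ℝ (PiLp (ENNReal.ofReal p) (fun _ : Fin m => ℝ)) := by
    ext c j
    change B (SobolevEmb (ENNReal.ofReal p) D (A c)) j = c j
    rw [hB]
    calc ∫ x, SobolevEmb (ENNReal.ofReal p) D (A c) x * (|w j x| ^ (p - 2) * w j x)
        = ∫ x, c j * |w j x| ^ p := by
          refine integral_congr_ae ?_
          filter_upwards [hA c, compLpL_proj0_ae_eq (A c : Vsp n (ENNReal.ofReal p))] with x hx hx'
          have h1 : SobolevEmb (ENNReal.ofReal p) D (A c) x = ∑ l, c l * w l x := by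
            refine hx'.trans ?_
            rw [hx]
            simp [jet]
          rw [h1, ← mul_abs_rpow_mul_self hp, Finset.sum_mul,
            Fintype.sum_eq_single j, mul_assoc]
          intro l hl
          by_cases hxl : x ∈ tsupport (w l)
          · rw [image_eq_zero_of_notMem_tsupport (Set.disjoint_left.1 (hd hl) hxl)]
            ring
          · rw [image_eq_zero_of_notMem_tsupport hxl]
            ring
      _ = c j := by rw [integral_const_mul, hw1, mul_one]
  have hs := σ.comp_le A (SobolevEmb (ENNReal.ofReal p) D) B m hm
  rw [hid, σ.id_eq_one m hm (by
    rw [(WithLp.linearEquiv (ENNReal.ofReal p) ℝ (Fin m → ℝ)).rank_eq]; simp)] at hs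
  have hs0 := σ.nonneg (SobolevEmb (ENNReal.ofReal p) D) m
  calc 1 ≤ ‖B‖ * σ.s (SobolevEmb (ENNReal.ofReal p) D) m * ‖A‖ := hs
    _ ≤ 1 * σ.s (SobolevEmb (ENNReal.ofReal p) D) m * K ^ (1 / p) := by gcongr
    _ = σ.s (SobolevEmb (ENNReal.ofReal p) D) m * K ^ (1 / p) := by rw [one_mul]

end LowerBound

lemma StrictSNumber.le_norm {X Y : Type} [NormedAddCommGroup X] [NormedSpace ℝ X]
    [CompleteSpace X] [NormedAddCommGroup Y] [NormedSpace ℝ Y] [CompleteSpace Y]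
    (σ : StrictSNumber) (T : X →L[ℝ] Y) {m : ℕ} (hm : 1 ≤ m) : σ.s T m ≤ ‖T‖ := by
  induction m, hm using Nat.le_induction with
  | base => exact (σ.first_eq_norm T).le
  | succ m hm ih => exact (σ.antitone T m hm).trans ih

lemma rpow_le_sNumber_sobolevEmb {n k : ℕ} (hk1 : 1 ≤ k) (hk : k < n) {p : ℝ} (hp : 1 < p)
    {a b : Fin n → ℝ} (hab : ∀ i : Fin n, k ≤ (i : ℕ) → a i < b i)
    [Fact (1 ≤ ENNReal.ofReal p)] (σ : StrictSNumber) {m : ℕ} (hm : 1 ≤ m) :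
    (1 + ∑ i ∈ Finset.univ.filter (fun i : Fin n => k ≤ (i : ℕ)),
        (p - 1) * (piP p / (b i - a i)) ^ p) ^ (-1 / p) ≤
      σ.s (SobolevEmb (ENNReal.ofReal p) (stripDomain n k a b)) m := by
  have hp0 : 0 < p := by linarith
  have hpi := piP_pos hp
  have hpos : 0 ≤ ∑ i ∈ Finset.univ.filter (fun i : Fin n => k ≤ (i : ℕ)),
      (p - 1) * (piP p / (b i - a i)) ^ p := by
    refine Finset.sum_nonneg fun i hi => ?_
    have := hab i (Finset.mem_filter.1 hi).2
    have hba : 0 < b i - a i := by linarith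
    exact mul_nonneg (by linarith) (by positivity)
  set c := ∑ i ∈ Finset.univ.filter (fun i : Fin n => k ≤ (i : ℕ)),
    (p - 1) * (piP p / (b i - a i)) ^ p with hc
  have key : ∀ ε > 0, (1 + c + ε) ^ (-1 / p) ≤
      σ.s (SobolevEmb (ENNReal.ofReal p) (stripDomain n k a b)) m := fun ε hε => by
    obtain ⟨u, hu, hd, hu1, hup⟩ := exists_testFun_family hk1 hk hp hab hε
    have hK : 0 < 1 + c + ε := by positivity
    have h := one_le_mul_sNumber hp hm (w := fun j : Fin m => u j) (fun j => hu j)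
      (fun j l hjl => hd fun h => hjl (Fin.ext h)) (fun j => hu1 j) hK.le (fun j => by
        rw [(hu j).integral_norm_jet_rpow hp0, hu1 j]
        linarith [hup j]) σ
    rw [neg_div, Real.rpow_neg hK.le]
    rwa [inv_le_iff_one_le_mul₀ (by positivity)]
  have hlim : Tendsto (fun ε : ℝ => (1 + c + ε) ^ (-1 / p)) (𝓝[>] 0)
      (𝓝 ((1 + c) ^ (-1 / p))) := by
    have h : ContinuousAt (fun ε : ℝ => (1 + c + ε) ^ (-1 / p)) 0 :=
      (continuousAt_const.add continuousAt_id).rpow_const (Or.inl (by simp; positivity))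
    simpa [ContinuousAt] using h.tendsto.mono_left nhdsWithin_le_nhds
  exact le_of_tendsto hlim (eventually_mem_nhdsWithin.mono fun ε hε => key ε hε)

/-- For the canonical embedding `I : W₀^{1,p}(D) ↪ L^p(D)` on the
strip-like domain `D = ℝᵏ × ∏_{i=1}^{n-k} (aᵢ,bᵢ)`, every strict `s`-number satisfies
`s_m(I) = ‖I‖ = (1 + π_p^p (p-1) ∑ (bᵢ-aᵢ)^{-p})^{-1/p}` for every `m`. -/
theorem strict_sNumbers_sobolevEmbedding_stripDomain
    (n k : ℕ) (hn : 2 ≤ n) (hk1 : 1 ≤ k) (hk : k < n) (p : ℝ) (hp : 1 < p)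
    (a b : Fin n → ℝ) (hab : ∀ i : Fin n, k ≤ (i : ℕ) → a i < b i)
    (σ : StrictSNumber) (m : ℕ) (hm : 1 ≤ m) :
    letI : Fact (1 ≤ ENNReal.ofReal p) := ⟨ENNReal.one_le_ofReal.mpr hp.le⟩
    σ.s (SobolevEmb (ENNReal.ofReal p) (stripDomain n k a b)) m =
        ‖SobolevEmb (ENNReal.ofReal p) (stripDomain n k a b)‖ ∧
      ‖SobolevEmb (ENNReal.ofReal p) (stripDomain n k a b)‖ =
        (1 + piP p ^ p * (p - 1) *
          ∑ i ∈ Finset.univ.filter (fun i : Fin n => k ≤ (i : ℕ)),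
            (b i - a i) ^ (-p)) ^ (-1 / p) := by
  have : Fact (1 ≤ ENNReal.ofReal p) := ⟨ENNReal.one_le_ofReal.mpr hp.le⟩
  have hsum : 1 + piP p ^ p * (p - 1) *
      ∑ i ∈ Finset.univ.filter (fun i : Fin n => k ≤ (i : ℕ)), (b i - a i) ^ (-p) =
      1 + ∑ i ∈ Finset.univ.filter (fun i : Fin n => k ≤ (i : ℕ)),
        (p - 1) * (piP p / (b i - a i)) ^ p := by
    rw [Finset.mul_sum]
    congr 1
    refine Finset.sum_congr rfl fun i hi => ?_
    have hba : 0 ≤ b i - a i := by linarith [hab i (Finset.mem_filter.1 hi).2]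
    rw [Real.div_rpow (piP_pos hp).le hba, Real.rpow_neg hba]
    ring
  rw [hsum]
  have hlow := rpow_le_sNumber_sobolevEmb hk1 hk hp hab σ hm
  have hmid := σ.le_norm (SobolevEmb (ENNReal.ofReal p) (stripDomain n k a b)) hm
  have hup := norm_SobolevEmb_le (n := n) (k := k) hp hab
  exact ⟨hmid.antisymm (hup.trans hlow), hup.antisymm (hlow.trans hmid)⟩
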